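/- arXiv:2306.01718 — 5 statements merged into one kernel-verified Lean document; each statement's English description precedes it below -/
import Mathlib

section
/- Let F be any field and let S ⊆ F be any finite subset. Then the set of real numbers {liminf_{n→∞} SR(T^{⊠n})^{1/n} : n1, n2, n3 ∈ ℕ, T ∈ F^{n1} ⊗ F^{n2} ⊗ F^{n3} an order-three tensor all of whose coefficients in the standard bases lie in S} has no accumulation points. -/
open scoped BigOperators

namespace Paper

variable {F : Type*} [Field F]

/-- Restriction of order-three tensors: `T ≥ S` iff there exist linear maps
(given by matrices `L1, L2, L3`) carrying `T` to `S`. -/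
def Restricts {ι1 ι2 ι3 κ1 κ2 κ3 : Type*} [Fintype ι1] [Fintype ι2] [Fintype ι3]
    (T : ι1 → ι2 → ι3 → F) (S : κ1 → κ2 → κ3 → F) : Prop :=
  ∃ (L1 : κ1 → ι1 → F) (L2 : κ2 → ι2 → F) (L3 : κ3 → ι3 → F),
    ∀ a b c, S a b c = ∑ i, ∑ j, ∑ k, L1 a i * L2 b j * L3 c k * T i j k

/-- The unit (diagonal) tensor `⟨r⟩`. -/
def unitTensor (F : Type*) [Field F] (r : ℕ) : Fin r → Fin r → Fin r → F :=
  fun i j k => if i = j ∧ j = k then 1 else 0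

/-- The subrank `Q(T)`: the largest `r` such that `T` restricts to `⟨r⟩`. -/
noncomputable def subrank {ι1 ι2 ι3 : Type*} [Fintype ι1] [Fintype ι2] [Fintype ι3]
    (T : ι1 → ι2 → ι3 → F) : ℕ :=
  sSup {r : ℕ | Restricts T (unitTensor F r)}

/-- Kronecker (tensor) power `T^{⊠ m}` of an order-three tensor. -/
def kronPow {ι1 ι2 ι3 : Type*} (T : ι1 → ι2 → ι3 → F) (m : ℕ) :
    (Fin m → ι1) → (Fin m → ι2) → (Fin m → ι3) → F :=
  fun x y z => ∏ s : Fin m, T (x s) (y s) (z s)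

/-- Asymptotic subrank `Q~(T) = lim_n Q(T^{⊠n})^{1/n} = sup_n Q(T^{⊠n})^{1/n}`. -/
noncomputable def asympSubrank {ι1 ι2 ι3 : Type*} [Fintype ι1] [Fintype ι2] [Fintype ι3]
    (T : ι1 → ι2 → ι3 → F) : ℝ :=
  ⨆ m : ℕ, (subrank (kronPow T (m + 1)) : ℝ) ^ ((1 : ℝ) / (m + 1))

/-- First flattening of a tensor. -/
def flattening1 {ι1 ι2 ι3 : Type*} (T : ι1 → ι2 → ι3 → F) : Matrix ι1 (ι2 × ι3) F :=
  Matrix.of fun i p => T i p.1 p.2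

/-- Second flattening of a tensor. -/
def flattening2 {ι1 ι2 ι3 : Type*} (T : ι1 → ι2 → ι3 → F) : Matrix ι2 (ι1 × ι3) F :=
  Matrix.of fun j p => T p.1 j p.2

/-- Third flattening of a tensor. -/
def flattening3 {ι1 ι2 ι3 : Type*} (T : ι1 → ι2 → ι3 → F) : Matrix ι3 (ι1 × ι2) F :=
  Matrix.of fun k p => T p.1 p.2 k

/-- A tensor is concise if all three flattening ranks are maximal. -/
noncomputable def Concise {ι1 ι2 ι3 : Type*} [Fintype ι1] [Fintype ι2] [Fintype ι3]
    (T : ι1 → ι2 → ι3 → F) : Prop :=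
  (flattening1 T).rank = Fintype.card ι1 ∧
  (flattening2 T).rank = Fintype.card ι2 ∧
  (flattening3 T).rank = Fintype.card ι3

/-- A tensor has slice rank one if one of its flattenings has rank one. -/
noncomputable def SliceRankOne {ι1 ι2 ι3 : Type*} [Fintype ι1] [Fintype ι2] [Fintype ι3]
    (T : ι1 → ι2 → ι3 → F) : Prop :=
  (flattening1 T).rank = 1 ∨ (flattening2 T).rank = 1 ∨ (flattening3 T).rank = 1

/-- The slice rank `SR(T)`: the least `r` such that `T` is a sum of `r` slice-rank-one
tensors. -/
noncomputable def sliceRank {ι1 ι2 ι3 : Type*} [Fintype ι1] [Fintype ι2] [Fintype ι3]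
    (T : ι1 → ι2 → ι3 → F) : ℕ :=
  sInf {r : ℕ | ∃ f : Fin r → (ι1 → ι2 → ι3 → F),
    (∀ t, SliceRankOne (f t)) ∧ T = ∑ t, f t}

/-- The liminf-asymptotic slice rank. -/
noncomputable def asympSliceRankInf {ι1 ι2 ι3 : Type*} [Fintype ι1] [Fintype ι2] [Fintype ι3]
    (T : ι1 → ι2 → ι3 → F) : ℝ :=
  Filter.liminf (fun m : ℕ => (sliceRank (kronPow T m) : ℝ) ^ ((1 : ℝ) / m)) Filter.atTop

/-- The limsup-asymptotic slice rank. -/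
noncomputable def asympSliceRankSup {ι1 ι2 ι3 : Type*} [Fintype ι1] [Fintype ι2] [Fintype ι3]
    (T : ι1 → ι2 → ι3 → F) : ℝ :=
  Filter.limsup (fun m : ℕ => (sliceRank (kronPow T m) : ℝ) ^ ((1 : ℝ) / m)) Filter.atTop

/-- The max-rank of a matrix subspace. -/
noncomputable def maxrank {m n : Type*} [Fintype n] (𝒜 : Submodule F (Matrix m n F)) : ℕ :=
  sSup {r : ℕ | ∃ A ∈ 𝒜, A.rank = r}

/-- The min-rank of a matrix subspace: the least rank of a nonzero element. -/
noncomputable def minrank {m n : Type*} [Fintype n] (𝒜 : Submodule F (Matrix m n F)) : ℕ :=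
  sInf {r : ℕ | ∃ A ∈ 𝒜, A ≠ 0 ∧ A.rank = r}

section Slices

variable {n1 n2 n3 : ℕ}

/-- Span of the 3-slices, rows indexed by direction 1, columns by direction 2. -/
def span12 (T : Fin n1 → Fin n2 → Fin n3 → F) : Submodule F (Matrix (Fin n1) (Fin n2) F) :=
  Submodule.span F (Set.range fun k : Fin n3 => Matrix.of fun i j => T i j k)

/-- Span of the 3-slices, rows indexed by direction 2, columns by direction 1. -/
def span21 (T : Fin n1 → Fin n2 → Fin n3 → F) : Submodule F (Matrix (Fin n2) (Fin n1) F) :=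
  Submodule.span F (Set.range fun k : Fin n3 => Matrix.of fun j i => T i j k)

/-- Span of the 2-slices, rows indexed by direction 1, columns by direction 3. -/
def span13 (T : Fin n1 → Fin n2 → Fin n3 → F) : Submodule F (Matrix (Fin n1) (Fin n3) F) :=
  Submodule.span F (Set.range fun j : Fin n2 => Matrix.of fun i k => T i j k)

/-- Span of the 2-slices, rows indexed by direction 3, columns by direction 1. -/
def span31 (T : Fin n1 → Fin n2 → Fin n3 → F) : Submodule F (Matrix (Fin n3) (Fin n1) F) :=
  Submodule.span F (Set.range fun j : Fin n2 => Matrix.of fun k i => T i j k)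

/-- Span of the 1-slices, rows indexed by direction 2, columns by direction 3. -/
def span23 (T : Fin n1 → Fin n2 → Fin n3 → F) : Submodule F (Matrix (Fin n2) (Fin n3) F) :=
  Submodule.span F (Set.range fun i : Fin n1 => Matrix.of fun j k => T i j k)

/-- Span of the 1-slices, rows indexed by direction 3, columns by direction 2. -/
def span32 (T : Fin n1 → Fin n2 → Fin n3 → F) : Submodule F (Matrix (Fin n3) (Fin n2) F) :=
  Submodule.span F (Set.range fun i : Fin n1 => Matrix.of fun k j => T i j k)

/-- `Q_1(T)`: max-rank of the span of the 1-slices. -/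
noncomputable def Q1 (T : Fin n1 → Fin n2 → Fin n3 → F) : ℕ := maxrank (span23 T)

/-- `Q_2(T)`: max-rank of the span of the 2-slices. -/
noncomputable def Q2 (T : Fin n1 → Fin n2 → Fin n3 → F) : ℕ := maxrank (span13 T)

/-- `Q_3(T)`: max-rank of the span of the 3-slices. -/
noncomputable def Q3 (T : Fin n1 → Fin n2 → Fin n3 → F) : ℕ := maxrank (span12 T)

end Slices

/-- `p` is the pivot of the matrix `A`: the lexicographically least position of a
nonzero entry. -/
def IsPivot {n1 n2 : ℕ} (A : Matrix (Fin n1) (Fin n2) F) (p : Fin n1 × Fin n2) : Prop :=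
  A p.1 p.2 ≠ 0 ∧ ∀ q : Fin n1 × Fin n2, A q.1 q.2 ≠ 0 → p.1 < q.1 ∨ (p.1 = q.1 ∧ p.2 ≤ q.2)

/-- The set of pivots of a matrix subspace (equal to the pivots of any basis with
pairwise distinct pivots). -/
def pivotSet {n1 n2 : ℕ} (𝒜 : Submodule F (Matrix (Fin n1) (Fin n2) F)) :
    Set (Fin n1 × Fin n2) :=
  {p | ∃ A ∈ 𝒜, IsPivot A p}

/-- `ρ(𝒜)`: the least `r = |S1| + |S2|` such that the pivots of `𝒜` are covered by the
rows `S1` and columns `S2`. -/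
noncomputable def rho {n1 n2 : ℕ} (𝒜 : Submodule F (Matrix (Fin n1) (Fin n2) F)) : ℕ :=
  sInf {r : ℕ | ∃ (S1 : Finset (Fin n1)) (S2 : Finset (Fin n2)),
    S1.card + S2.card = r ∧ ∀ p ∈ pivotSet 𝒜, p.1 ∈ S1 ∨ p.2 ∈ S2}

/-- The border subrank `Q̲(T)`: the largest `r` such that, over Laurent polynomials
in `ε`, some restriction of `T` equals `⟨r⟩ + ε S_1 + ⋯ + ε^t S_t`. -/
noncomputable def borderSubrank {ι1 ι2 ι3 : Type*} [Fintype ι1] [Fintype ι2] [Fintype ι3]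
    (T : ι1 → ι2 → ι3 → F) : ℕ :=
  sSup {r : ℕ |
    ∃ (A : Fin r → ι1 → LaurentPolynomial F) (B : Fin r → ι2 → LaurentPolynomial F)
      (C : Fin r → ι3 → LaurentPolynomial F) (t : ℕ)
      (S : Fin t → (Fin r → Fin r → Fin r → F)),
      ∀ a b c,
        (∑ i, ∑ j, ∑ k, A a i * B b j * C c k * LaurentPolynomial.C (T i j k)) =
          LaurentPolynomial.C (unitTensor F r a b c) +
            ∑ s : Fin t, LaurentPolynomial.T (((s : ℕ) : ℤ) + 1) *
              LaurentPolynomial.C (S s a b c)}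

/-- The linear map `A ↦ U * A * V` on rectangular matrices. -/
def conjMap {n1 n2 : ℕ} (U : Matrix (Fin n1) (Fin n1) F) (V : Matrix (Fin n2) (Fin n2) F) :
    Matrix (Fin n1) (Fin n2) F →ₗ[F] Matrix (Fin n1) (Fin n2) F where
  toFun A := U * A * V
  map_add' A B := by simp [Matrix.mul_add, Matrix.add_mul]
  map_smul' c A := by simp [Matrix.mul_smul, Matrix.smul_mul]

/-- The principal submatrix `A_{J×J}`, where `J ⊆ [min{n1,n2}]` is encoded by the
map `η`. -/
def restrictJJ {n1 n2 jn : ℕ} (η : Fin jn → Fin (min n1 n2))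
    (A : Matrix (Fin n1) (Fin n2) F) : Matrix (Fin jn) (Fin jn) F :=
  Matrix.of fun p q =>
    A (Fin.castLE (min_le_left n1 n2) (η p)) (Fin.castLE (min_le_right n1 n2) (η q))

/-- An order-three tensor over `F` of arbitrary format. -/
structure Tensor3 (F : Type*) [Field F] where
  n1 : ℕ
  n2 : ℕ
  n3 : ℕ
  coef : Fin n1 → Fin n2 → Fin n3 → F

/-- Two tensors are equivalent if each restricts to the other. -/
def Tensor3.Equivalent (T S : Tensor3 F) : Prop :=
  Restricts T.coef S.coef ∧ Restricts S.coef T.coef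

/-- A rank-one order-`k` tensor: a tensor product of `k` nonzero vectors. -/
def RankOne {k : ℕ} {ι : Fin k → Type*} (T : ((i : Fin k) → ι i) → F) : Prop :=
  ∃ u : (i : Fin k) → (ι i → F), (∀ i, u i ≠ 0) ∧ ∀ v, T v = ∏ i, u i (v i)

/-- The tensor rank of an order-`k` tensor. -/
noncomputable def tensorRank {k : ℕ} {ι : Fin k → Type*} (T : ((i : Fin k) → ι i) → F) : ℕ :=
  sInf {r : ℕ | ∃ f : Fin r → (((i : Fin k) → ι i) → F),
    (∀ t, RankOne (f t)) ∧ T = ∑ t, f t}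

/-- Kronecker power of an order-`k` tensor. -/
def kronPowK {k : ℕ} {ι : Fin k → Type*} (T : ((i : Fin k) → ι i) → F) (m : ℕ) :
    ((i : Fin k) → (Fin m → ι i)) → F :=
  fun v => ∏ s : Fin m, T fun i => v i s

/-- The asymptotic rank `R~(T) = lim_n R(T^{⊠n})^{1/n} = inf_n R(T^{⊠n})^{1/n}`. -/
noncomputable def asympRank {k : ℕ} {ι : Fin k → Type*} (T : ((i : Fin k) → ι i) → F) : ℝ :=
  ⨅ m : ℕ, (tensorRank (kronPowK T (m + 1)) : ℝ) ^ ((1 : ℝ) / (m + 1))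

section SliceRank

variable {ι1 ι2 ι3 κ1 κ2 κ3 : Type*} [Fintype ι1] [Fintype ι2] [Fintype ι3]
  [Fintype κ1] [Fintype κ2] [Fintype κ3]

theorem exists_outer_of_rank_eq_one {m n : Type*} [Fintype n] (A : Matrix m n F)
    (h : A.rank = 1) : ∃ (a : m → F) (b : n → F), ∀ i j, A i j = a i * b j := by
  obtain ⟨v, -, hv⟩ := finrank_eq_one_iff'.1 h
  have hcol : ∀ j, ∃ c : F, ∀ i, A i j = v.1 i * c := by
    intro j
    classical
    obtain ⟨c, hc⟩ := hv ⟨A.mulVecLin (Pi.single j 1), LinearMap.mem_range_self _ _⟩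
    refine ⟨c, fun i => ?_⟩
    have := congrFun (congrArg Subtype.val hc) i
    simp only [Submodule.coe_smul, Pi.smul_apply, smul_eq_mul, Matrix.mulVecLin_apply,
      Matrix.mulVec_single_one, Matrix.col_apply] at this
    rw [← this, mul_comm]
  choose b hb using hcol
  exact ⟨v.1, b, fun i j => hb j i⟩

theorem rank_eq_one_of_outer {m n : Type*} [Fintype n] (A : Matrix m n F)
    (a : m → F) (b : n → F) (hA : ∀ i j, A i j = a i * b j) {i : m} {j : n} (h : A i j ≠ 0) :
    A.rank = 1 := by
  have hA' : A = Matrix.vecMulVec a b := by ext i j; simp [hA, Matrix.vecMulVec_apply]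
  refine le_antisymm (hA' ▸ Matrix.rank_vecMulVec_le _ _) ?_
  by_contra hlt
  have h0 : Module.finrank F (LinearMap.range A.mulVecLin) = 0 := by
    have : A.rank = 0 := by omega
    exact this
  have h1 := Submodule.finrank_eq_zero.1 h0
  classical
  have h2 : A.mulVecLin (Pi.single j 1) = 0 := by
    rw [← Submodule.mem_bot F, ← h1]; exact LinearMap.mem_range_self _ _
  exact h (by simpa using congrFun h2 i)

/-- Slice rank at most one: the tensor is an outer product of a vector on one leg and a matrix
on the other two. -/
def IsSlice {ι1 ι2 ι3 : Type*} (T : ι1 → ι2 → ι3 → F) : Prop :=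
  (∃ (a : ι1 → F) (A : ι2 → ι3 → F), ∀ i j k, T i j k = a i * A j k) ∨
  (∃ (b : ι2 → F) (B : ι1 → ι3 → F), ∀ i j k, T i j k = b j * B i k) ∨
  (∃ (c : ι3 → F) (C : ι1 → ι2 → F), ∀ i j k, T i j k = c k * C i j)

theorem SliceRankOne.isSlice {T : ι1 → ι2 → ι3 → F} (h : SliceRankOne T) : IsSlice T := by
  rcases h with h | h | h
  · obtain ⟨a, b, hab⟩ := exists_outer_of_rank_eq_one _ h
    exact Or.inl ⟨a, fun j k => b (j, k), fun i j k => hab i (j, k)⟩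
  · obtain ⟨a, b, hab⟩ := exists_outer_of_rank_eq_one _ h
    exact Or.inr (Or.inl ⟨a, fun j k => b (j, k), fun i j k => hab j (i, k)⟩)
  · obtain ⟨a, b, hab⟩ := exists_outer_of_rank_eq_one _ h
    exact Or.inr (Or.inr ⟨a, fun j k => b (j, k), fun i j k => hab k (i, j)⟩)

theorem IsSlice.sliceRankOne {T : ι1 → ι2 → ι3 → F} (h : IsSlice T) (hT : T ≠ 0) :
    SliceRankOne T := by
  have : ∃ i j k, T i j k ≠ 0 := by
    by_contra! h0
    exact hT (by ext i j k; exact h0 i j k)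
  obtain ⟨i, j, k, hijk⟩ := this
  rcases h with ⟨a, A, h⟩ | ⟨a, A, h⟩ | ⟨a, A, h⟩
  · exact Or.inl (rank_eq_one_of_outer (flattening1 T) a (fun p => A p.1 p.2)
      (fun i p => h i p.1 p.2) (i := i) (j := (j, k)) hijk)
  · exact Or.inr (Or.inl (rank_eq_one_of_outer (flattening2 T) a (fun p => A p.1 p.2)
      (fun i p => h p.1 i p.2) (i := j) (j := (i, k)) hijk))
  · exact Or.inr (Or.inr (rank_eq_one_of_outer (flattening3 T) a (fun p => A p.1 p.2)
      (fun i p => h p.1 p.2 i) (i := k) (j := (i, j)) hijk))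

theorem exists_sliceRankOne_sum {τ : Type*} [Fintype τ] (f : τ → ι1 → ι2 → ι3 → F)
    (hf : ∀ t, IsSlice (f t)) :
    ∃ r ≤ Fintype.card τ, ∃ g : Fin r → (ι1 → ι2 → ι3 → F),
      (∀ t, SliceRankOne (g t)) ∧ ∑ t, f t = ∑ t, g t := by
  classical
  let s : Finset τ := Finset.univ.filter fun t => f t ≠ 0
  refine ⟨s.card, s.card_le_univ, fun t => f (s.equivFin.symm t), fun t => ?_, ?_⟩
  · exact (hf _).sliceRankOne (Finset.mem_filter.1 (s.equivFin.symm t).2).2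
  · rw [Equiv.sum_comp s.equivFin.symm (fun t : s => f t), Finset.sum_coe_sort s f,
      Finset.sum_filter_ne_zero]

theorem sliceRank_le_card {τ : Type*} [Fintype τ] {T : ι1 → ι2 → ι3 → F}
    (f : τ → ι1 → ι2 → ι3 → F) (hf : ∀ t, IsSlice (f t)) (h : T = ∑ t, f t) :
    sliceRank T ≤ Fintype.card τ := by
  obtain ⟨r, hr, g, hg, hs⟩ := exists_sliceRankOne_sum f hf
  refine le_trans ?_ hr
  unfold sliceRank
  exact Nat.sInf_le ⟨g, hg, h.trans hs⟩

theorem exists_slice_decomposition_fst {α β γ : Type*} [Fintype α] (T : α → β → γ → F) :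
    ∃ f : α → α → β → γ → F, (∀ t, IsSlice (f t)) ∧ T = ∑ t, f t := by
  classical
  refine ⟨fun t i j k => (if i = t then 1 else 0) * T t j k, fun t =>
    Or.inl ⟨fun i => if i = t then 1 else 0, fun j k => T t j k, fun _ _ _ => rfl⟩, ?_⟩
  ext i j k
  simp [Finset.sum_apply]

theorem sliceRank_le_card_fst (T : ι1 → ι2 → ι3 → F) : sliceRank T ≤ Fintype.card ι1 := by
  obtain ⟨f, hf, h⟩ := exists_slice_decomposition_fst T
  exact sliceRank_le_card f hf h

theorem exists_sliceRank_decomposition (T : ι1 → ι2 → ι3 → F) :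
    ∃ f : Fin (sliceRank T) → ι1 → ι2 → ι3 → F, (∀ t, IsSlice (f t)) ∧ T = ∑ t, f t := by
  have hne : {r : ℕ | ∃ f : Fin r → (ι1 → ι2 → ι3 → F),
      (∀ t, SliceRankOne (f t)) ∧ T = ∑ t, f t}.Nonempty := by
    obtain ⟨f, hf, h⟩ := exists_slice_decomposition_fst T
    obtain ⟨r, -, g, hg, hs⟩ := exists_sliceRankOne_sum f hf
    exact ⟨r, g, hg, h.trans hs⟩
  obtain ⟨f, hf, h⟩ := Nat.sInf_mem hne
  exact ⟨f, fun t => (hf t).isSlice, h⟩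

theorem sliceRank_mono {T : ι1 → ι2 → ι3 → F} {S : κ1 → κ2 → κ3 → F} (h : Restricts T S) :
    sliceRank S ≤ sliceRank T := by
  obtain ⟨L1, L2, L3, hL⟩ := h
  obtain ⟨f, hf, hT⟩ := exists_sliceRank_decomposition T
  have := sliceRank_le_card (T := S)
    (fun t a b c => ∑ i, ∑ j, ∑ k, L1 a i * L2 b j * L3 c k * f t i j k) (fun t => ?_) ?_
  · simpa using this
  · rcases hf t with ⟨a, A, h⟩ | ⟨a, A, h⟩ | ⟨a, A, h⟩
    · refine Or.inl ⟨fun p => ∑ i, L1 p i * a i, fun q r => ∑ j, ∑ k, L2 q j * L3 r k * A j k,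
        fun p q r => ?_⟩
      rw [Finset.sum_mul]
      refine Finset.sum_congr rfl fun i _ => ?_
      simp only [Finset.mul_sum, h]
      exact Finset.sum_congr rfl fun j _ => Finset.sum_congr rfl fun k _ => by ring
    · refine Or.inr (Or.inl ⟨fun q => ∑ j, L2 q j * a j,
        fun p r => ∑ i, ∑ k, L1 p i * L3 r k * A i k, fun p q r => ?_⟩)
      dsimp only
      rw [Finset.sum_comm, Finset.sum_mul_sum]
      refine Finset.sum_congr rfl fun j _ => Finset.sum_congr rfl fun i _ => ?_
      simp only [Finset.mul_sum, h]
      exact Finset.sum_congr rfl fun k _ => by ring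
    · refine Or.inr (Or.inr ⟨fun r => ∑ k, L3 r k * a k,
        fun p q => ∑ i, ∑ j, L1 p i * L2 q j * A i j, fun p q r => ?_⟩)
      simp only [Finset.mul_sum, Finset.sum_mul, h]
      refine Finset.sum_congr rfl fun i _ => Finset.sum_congr rfl fun j _ =>
        Finset.sum_congr rfl fun k _ => by ring
  · ext a b c
    simp only [Finset.sum_apply, hL]
    symm
    rw [Finset.sum_comm]
    refine Finset.sum_congr rfl fun i _ => ?_
    rw [Finset.sum_comm]
    refine Finset.sum_congr rfl fun j _ => ?_
    rw [Finset.sum_comm]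
    refine Finset.sum_congr rfl fun k _ => ?_
    rw [← Finset.mul_sum]
    conv_rhs => rw [hT]
    simp [Finset.sum_apply]

theorem sliceRank_swap12_le (T : ι1 → ι2 → ι3 → F) :
    sliceRank (fun j i k => T i j k) ≤ sliceRank T := by
  obtain ⟨f, hf, hT⟩ := exists_sliceRank_decomposition T
  have := sliceRank_le_card (T := fun j i k => T i j k) (fun t j i k => f t i j k)
    (fun t => ?_) ?_
  · simpa using this
  · rcases hf t with ⟨a, A, h⟩ | ⟨a, A, h⟩ | ⟨a, A, h⟩
    · exact Or.inr (Or.inl ⟨a, A, fun p q r => h q p r⟩)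
    · exact Or.inl ⟨a, A, fun p q r => h q p r⟩
    · exact Or.inr (Or.inr ⟨a, fun i j => A j i, fun p q r => h q p r⟩)
  · ext j i k
    conv_lhs => rw [hT]
    simp [Finset.sum_apply]

theorem sliceRank_swap23_le (T : ι1 → ι2 → ι3 → F) :
    sliceRank (fun i k j => T i j k) ≤ sliceRank T := by
  obtain ⟨f, hf, hT⟩ := exists_sliceRank_decomposition T
  have := sliceRank_le_card (T := fun i k j => T i j k) (fun t i k j => f t i j k)
    (fun t => ?_) ?_
  · simpa using this
  · rcases hf t with ⟨a, A, h⟩ | ⟨a, A, h⟩ | ⟨a, A, h⟩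
    · exact Or.inl ⟨a, fun i j => A j i, fun p q r => h p r q⟩
    · exact Or.inr (Or.inr ⟨a, A, fun p q r => h p r q⟩)
    · exact Or.inr (Or.inl ⟨a, A, fun p q r => h p r q⟩)
  · ext j i k
    conv_lhs => rw [hT]
    simp [Finset.sum_apply]

theorem sliceRank_swap12 (T : ι1 → ι2 → ι3 → F) :
    sliceRank (fun j i k => T i j k) = sliceRank T :=
  le_antisymm (sliceRank_swap12_le T) (sliceRank_swap12_le fun j i k => T i j k)

theorem sliceRank_swap23 (T : ι1 → ι2 → ι3 → F) :
    sliceRank (fun i k j => T i j k) = sliceRank T :=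
  le_antisymm (sliceRank_swap23_le T) (sliceRank_swap23_le fun i k j => T i j k)

/-- A subspace of a coordinate space contains a vector whose support is at least as large as
the dimension. -/
theorem exists_finrank_le_card_support {κ : Type*} [Fintype κ] [DecidableEq F]
    (H : Submodule F (κ → F)) :
    ∃ h ∈ H, Module.finrank F H ≤ (Finset.univ.filter fun i => h i ≠ 0).card := by
  classical
  let supp : (κ → F) → Finset κ := fun h => Finset.univ.filter fun i => h i ≠ 0
  have : Nonempty {n : Fin (Fintype.card κ + 1) // ∃ h ∈ H, (supp h).card = n} :=
    ⟨⟨⟨(supp 0).card, Nat.lt_succ_of_le (Finset.card_le_univ _)⟩, 0, H.zero_mem, rfl⟩⟩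
  obtain ⟨h, hmax⟩ := Finite.exists_max
    (fun n : {n : Fin (Fintype.card κ + 1) // ∃ h ∈ H, (supp h).card = n} => n.1)
  obtain ⟨⟨n, hn⟩, g, hg, hgn⟩ := h
  refine ⟨g, hg, ?_⟩
  by_contra! hlt
  let φ : H →ₗ[F] (supp g → F) := (LinearMap.funLeft F F Subtype.val) ∘ₗ H.subtype
  have hker : LinearMap.ker φ ≠ ⊥ :=
    LinearMap.ker_ne_bot_of_finrank_lt (by
      rw [Module.finrank_fintype_fun_eq_card, Fintype.card_coe]; exact hlt)
  obtain ⟨w, hw, hw0⟩ := Submodule.exists_mem_ne_zero_of_ne_bot hker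
  have hwg : ∀ i, g i ≠ 0 → w.1 i = 0 := fun i hi =>
    congrFun (LinearMap.mem_ker.1 hw) ⟨i, by simp [supp, hi]⟩
  obtain ⟨i, hi⟩ : ∃ i, w.1 i ≠ 0 := by
    by_contra! h0
    exact hw0 (Subtype.ext (funext h0))
  have hss : supp g ⊂ supp (g + w.1) := by
    refine Finset.ssubset_iff_of_subset (fun j hj => ?_) |>.2 ⟨i, ?_, ?_⟩
    · have : g j ≠ 0 := by simpa [supp] using hj
      simp [supp, hwg j this, this]
    · have : g i = 0 := by
        by_contra hgi
        exact hi (hwg i hgi)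
      simp [supp, this, hi]
    · intro hmem
      exact hi (hwg i (by simpa [supp] using hmem))
  have := hmax ⟨⟨(supp (g + w.1)).card, Nat.lt_succ_of_le (Finset.card_le_univ _)⟩,
    g + w.1, H.add_mem hg w.2, rfl⟩
  have hc := Finset.card_lt_card hss
  simp only [Fin.mk_le_mk] at this
  simp only at hgn
  omega

/-- The diagonal tensor on an arbitrary index type. -/
def diagTensor (F : Type*) [Field F] (κ : Type*) [DecidableEq κ] : κ → κ → κ → F :=
  fun a b c => if a = b ∧ b = c then 1 else 0

theorem card_le_sliceRank_diagTensor (κ : Type*) [Fintype κ] [DecidableEq κ] :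
    Fintype.card κ ≤ sliceRank (diagTensor F κ) := by
  classical
  obtain ⟨f, hf, hT⟩ := exists_sliceRank_decomposition (diagTensor F κ)
  let P : Fin (sliceRank (diagTensor F κ)) → Prop := fun t =>
    ∃ (a : κ → F) (A : κ → κ → F), ∀ i j k, f t i j k = a i * A j k
  choose a A haA using fun t : {t // P t} => t.2
  let φ : (κ → F) →ₗ[F] ({t // P t} → F) :=
    LinearMap.pi fun t => ∑ i, a t i • LinearMap.proj i
  have hH : Fintype.card κ ≤ Module.finrank F (LinearMap.ker φ) + Fintype.card {t // P t} := by
    have h1 := LinearMap.finrank_range_add_finrank_ker φ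
    have h2 := Submodule.finrank_le (LinearMap.range φ)
    simp only [Module.finrank_fintype_fun_eq_card] at h1 h2
    omega
  obtain ⟨h, hh, hcard⟩ := exists_finrank_le_card_support (LinearMap.ker φ)
  have hφ : ∀ t : {t // P t}, ∑ i, h i * a t i = 0 := fun t => by
    have := congrFun (LinearMap.mem_ker.1 hh) t
    simpa [φ, LinearMap.pi_apply, LinearMap.sum_apply, mul_comm] using this
  have hQ : ∀ t : {t // ¬ P t}, ∃ (p q : κ → F), ∀ j k, ∑ i, h i * f t i j k = p j * q k := by
    rintro ⟨t, ht⟩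
    rcases hf t with h1 | ⟨b, B, hb⟩ | ⟨c, C, hc⟩
    · exact absurd h1 ht
    · refine ⟨b, fun k => ∑ i, h i * B i k, fun j k => ?_⟩
      simp only [hb, Finset.mul_sum]
      exact Finset.sum_congr rfl fun i _ => by ring
    · refine ⟨fun j => ∑ i, h i * C i j, c, fun j k => ?_⟩
      simp only [hc, Finset.sum_mul]
      exact Finset.sum_congr rfl fun i _ => by ring
  choose p q hpq using hQ
  have hmat : Matrix.diagonal h =
      (Matrix.of fun j t => p t j) * (Matrix.of fun t k => q t k) := by
    ext j k
    rw [Matrix.mul_apply]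
    have h1 : Matrix.diagonal h j k = ∑ i, h i * diagTensor F κ i j k := by
      simp only [diagTensor, Matrix.diagonal_apply]
      by_cases hjk : j = k
      · subst hjk; simp
      · simp [hjk]
    have h3 : ∀ i, diagTensor F κ i j k = ∑ t, f t i j k := fun i => by
      conv_lhs => rw [hT]
      simp [Finset.sum_apply]
    rw [h1]
    simp only [h3, Finset.mul_sum]
    rw [Finset.sum_comm, ← Fintype.sum_subtype_add_sum_subtype P]
    have h2 : ∑ t : {t // P t}, ∑ i, h i * f t i j k = 0 := by
      refine Finset.sum_eq_zero fun t _ => ?_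
      simp only [haA, ← mul_assoc, ← Finset.sum_mul, hφ, zero_mul]
    rw [h2, zero_add]
    exact Finset.sum_congr rfl fun t _ => by simp [hpq]
  have hrank : (Matrix.diagonal h).rank ≤ Fintype.card {t // ¬ P t} := by
    rw [hmat]
    exact (Matrix.rank_mul_le_left _ _).trans (Matrix.rank_le_card_width _)
  rw [Matrix.rank_diagonal, Fintype.card_subtype] at hrank
  have := Fintype.card_subtype_compl P
  have h3 := Fintype.card_subtype_le P
  simp only [Fintype.card_fin] at this h3
  omega

theorem card_le_sliceRank {T : ι1 → ι2 → ι3 → F} (κ : Type*) [Fintype κ] [DecidableEq κ]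
    (h : Restricts T (diagTensor F κ)) : Fintype.card κ ≤ sliceRank T :=
  (card_le_sliceRank_diagTensor κ).trans (sliceRank_mono h)

end SliceRank

section Trilinear

variable {ι1 ι2 ι3 κ1 κ2 κ3 : Type*} [Fintype ι1] [Fintype ι2] [Fintype ι3]

/-- The trilinear form associated with a tensor. -/
def tri (T : ι1 → ι2 → ι3 → F) : (ι1 → F) →ₗ[F] (ι2 → F) →ₗ[F] (ι3 → F) →ₗ[F] F :=
  ∑ i, ∑ j, ∑ k, T i j k •
    (LinearMap.proj i).smulRight ((LinearMap.proj j).smulRight (LinearMap.proj k))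

theorem tri_apply (T : ι1 → ι2 → ι3 → F) (x : ι1 → F) (y : ι2 → F) (z : ι3 → F) :
    tri T x y z = ∑ i, ∑ j, ∑ k, x i * y j * z k * T i j k := by
  simp only [tri, LinearMap.sum_apply, LinearMap.smul_apply, LinearMap.smulRight_apply,
    LinearMap.proj_apply, smul_eq_mul]
  exact Finset.sum_congr rfl fun i _ => Finset.sum_congr rfl fun j _ =>
    Finset.sum_congr rfl fun k _ => by ring

theorem tri_single [DecidableEq ι1] [DecidableEq ι2] [DecidableEq ι3]
    (T : ι1 → ι2 → ι3 → F) (i : ι1) (j : ι2) (k : ι3) :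
    tri T (Pi.single i 1) (Pi.single j 1) (Pi.single k 1) = T i j k := by
  simp [tri_apply, Pi.single_apply]

theorem tri_swap12 (T : ι1 → ι2 → ι3 → F) (x : ι1 → F) (y : ι2 → F) (z : ι3 → F) :
    tri (fun j i k => T i j k) y x z = tri T x y z := by
  rw [tri_apply, tri_apply, Finset.sum_comm]
  exact Finset.sum_congr rfl fun i _ => Finset.sum_congr rfl fun j _ =>
    Finset.sum_congr rfl fun k _ => by ring

theorem tri_swap23 (T : ι1 → ι2 → ι3 → F) (x : ι1 → F) (y : ι2 → F) (z : ι3 → F) :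
    tri (fun i k j => T i j k) x z y = tri T x y z := by
  rw [tri_apply, tri_apply]
  refine Finset.sum_congr rfl fun i _ => ?_
  rw [Finset.sum_comm]
  exact Finset.sum_congr rfl fun j _ => Finset.sum_congr rfl fun k _ => by ring

theorem restricts_of_tri {T : ι1 → ι2 → ι3 → F} {S : κ1 → κ2 → κ3 → F}
    (L1 : κ1 → ι1 → F) (L2 : κ2 → ι2 → F) (L3 : κ3 → ι3 → F)
    (h : ∀ a b c, tri T (L1 a) (L2 b) (L3 c) = S a b c) : Restricts T S :=
  ⟨L1, L2, L3, fun a b c => by rw [← h, tri_apply]⟩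

/-- The tensor product of a finite sequence of vectors. -/
def pureVec {ι : Type*} {m : ℕ} (x : Fin m → ι → F) : (Fin m → ι) → F :=
  fun i => ∏ s, x s (i s)

theorem tri_kronPow (T : ι1 → ι2 → ι3 → F) {m : ℕ} (x : Fin m → ι1 → F) (y : Fin m → ι2 → F)
    (z : Fin m → ι3 → F) :
    tri (kronPow T m) (pureVec x) (pureVec y) (pureVec z) =
      ∏ s, tri T (x s) (y s) (z s) := by
  simp only [tri_apply, Fintype.prod_sum, pureVec, kronPow, ← Finset.prod_mul_distrib]

theorem Restricts.kronPow {T : ι1 → ι2 → ι3 → F} {S : κ1 → κ2 → κ3 → F} (h : Restricts T S)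
    (m : ℕ) : Restricts (kronPow T m) (kronPow S m) := by
  obtain ⟨L1, L2, L3, hL⟩ := h
  refine restricts_of_tri (fun a => pureVec fun s => L1 (a s)) (fun a => pureVec fun s => L2 (a s))
    (fun a => pureVec fun s => L3 (a s)) fun a b c => ?_
  rw [tri_kronPow]
  exact Finset.prod_congr rfl fun s _ => by rw [hL, tri_apply]

end Trilinear

section Asymptotics

open Filter Topology

variable {ι1 ι2 ι3 κ1 κ2 κ3 : Type*} [Fintype ι1] [Fintype ι2] [Fintype ι3]
  [Fintype κ1] [Fintype κ2] [Fintype κ3]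

theorem asympSliceRankInf_congr {T : ι1 → ι2 → ι3 → F} {S : κ1 → κ2 → κ3 → F}
    (h : Restricts T S) (h' : Restricts S T) : asympSliceRankInf T = asympSliceRankInf S := by
  have : ∀ m, sliceRank (kronPow T m) = sliceRank (kronPow S m) := fun m =>
    le_antisymm (sliceRank_mono (h'.kronPow m)) (sliceRank_mono (h.kronPow m))
  simp only [asympSliceRankInf, this]

theorem asympSliceRankInf_swap12 (T : ι1 → ι2 → ι3 → F) :
    asympSliceRankInf (fun j i k => T i j k) = asympSliceRankInf T := by
  have : ∀ m, sliceRank (kronPow (fun j i k => T i j k) m) = sliceRank (kronPow T m) := fun m =>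
    sliceRank_swap12 (kronPow T m)
  simp only [asympSliceRankInf, this]

theorem asympSliceRankInf_swap23 (T : ι1 → ι2 → ι3 → F) :
    asympSliceRankInf (fun i k j => T i j k) = asympSliceRankInf T := by
  have : ∀ m, sliceRank (kronPow (fun i k j => T i j k) m) = sliceRank (kronPow T m) := fun m =>
    sliceRank_swap23 (kronPow T m)
  simp only [asympSliceRankInf, this]

theorem sliceRank_kronPow_rpow_le (T : ι1 → ι2 → ι3 → F) {m : ℕ} (hm : m ≠ 0) :
    (sliceRank (kronPow T m) : ℝ) ^ ((1 : ℝ) / m) ≤ Fintype.card ι1 := by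
  classical
  have h := sliceRank_le_card_fst (kronPow T m)
  rw [Fintype.card_fun, Fintype.card_fin] at h
  calc (sliceRank (kronPow T m) : ℝ) ^ ((1 : ℝ) / m)
      ≤ ((Fintype.card ι1 : ℝ) ^ m) ^ ((1 : ℝ) / m) := by
        gcongr
        exact_mod_cast h
    _ = Fintype.card ι1 := by
        rw [one_div]
        exact Real.pow_rpow_inv_natCast (by positivity) hm

theorem asympSliceRankInf_le_card (T : ι1 → ι2 → ι3 → F) :
    asympSliceRankInf T ≤ Fintype.card ι1 := by
  refine liminf_le_of_frequently_le ?_ ⟨0, ?_⟩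
  · refine Eventually.frequently ?_
    filter_upwards [eventually_ne_atTop 0] with m hm using sliceRank_kronPow_rpow_le T hm
  · exact eventually_map.2 (Eventually.of_forall fun m => by positivity)

theorem le_asympSliceRankInf (T : ι1 → ι2 → ι3 → F) {N : ℕ} {c : ℝ} (hc : 0 < c)
    (h : ∀ᶠ m : ℕ in atTop, (N : ℝ) ^ m ≤ c * sliceRank (kronPow T m)) :
    (N : ℝ) ≤ asympSliceRankInf T := by
  have hlim : Tendsto (fun m : ℕ => (N : ℝ) * c⁻¹ ^ ((1 : ℝ) / m)) atTop (𝓝 (N : ℝ)) := by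
    have h1 : Tendsto (fun m : ℕ => c⁻¹ ^ ((1 : ℝ) / m)) atTop (𝓝 (c⁻¹ ^ (0 : ℝ))) :=
      tendsto_const_nhds.rpow tendsto_one_div_atTop_nhds_zero_nat (Or.inl (by positivity))
    simpa using h1.const_mul (N : ℝ)
  rw [← hlim.liminf_eq]
  refine liminf_le_liminf ?_ hlim.isBoundedUnder_ge ?_
  · filter_upwards [h, eventually_ne_atTop 0] with m hm hm0
    have h2 : (N : ℝ) ^ m * c⁻¹ ≤ sliceRank (kronPow T m) := by
      rw [mul_inv_le_iff₀ hc, mul_comm]; exact hm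
    calc (N : ℝ) * c⁻¹ ^ ((1 : ℝ) / m) = ((N : ℝ) ^ m * c⁻¹) ^ ((1 : ℝ) / m) := by
          rw [Real.mul_rpow (by positivity) (by positivity)]
          congr 1
          rw [one_div]
          exact (Real.pow_rpow_inv_natCast (by positivity) hm0).symm
      _ ≤ _ := by gcongr
  · refine IsBoundedUnder.isCoboundedUnder_ge ⟨Fintype.card ι1, ?_⟩
    rw [eventually_map]
    filter_upwards [eventually_ne_atTop 0] with m hm using sliceRank_kronPow_rpow_le T hm

end Asymptotics

section LinearAlgebra

open Module

variable {V V1 V2 V3 : Type*} [AddCommGroup V] [Module F V] [AddCommGroup V1] [Module F V1]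
  [AddCommGroup V2] [Module F V2] [AddCommGroup V3] [Module F V3]

theorem finrank_le_card_of_annihilator_eq_bot [FiniteDimensional F V] (α : Finset (Dual F V))
    (h : ∀ v, (∀ f ∈ α, f v = 0) → v = 0) : finrank F V ≤ α.card := by
  let φ : V →ₗ[F] (α → F) := LinearMap.pi fun f => f.1
  have hφ : Function.Injective φ := by
    rw [← LinearMap.ker_eq_bot, LinearMap.ker_eq_bot']
    exact fun v hv => h v fun f hf => congrFun hv ⟨f, hf⟩
  simpa using LinearMap.finrank_le_finrank_of_injective hφ

theorem exists_span_complement_annihilator (α : Finset (Dual F V)) :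
    ∃ X : Finset V, X.card ≤ α.card ∧
      ∀ v, ∃ x ∈ Submodule.span F (X : Set V), ∀ f ∈ α, f (v - x) = 0 := by
  classical
  induction α using Finset.induction_on with
  | empty => exact ⟨∅, le_rfl, fun v => ⟨0, Submodule.zero_mem _, by simp⟩⟩
  | insert f α hf ih =>
    obtain ⟨X, hX, hspan⟩ := ih
    rw [Finset.card_insert_of_notMem hf]
    by_cases h0 : ∀ v, (∀ g ∈ α, g v = 0) → f v = 0
    · refine ⟨X, by omega, fun v => ?_⟩
      obtain ⟨x, hx, hvx⟩ := hspan v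
      exact ⟨x, hx, fun g hg => (Finset.mem_insert.1 hg).elim (fun e => e ▸ h0 _ hvx) (hvx g)⟩
    · push Not at h0
      obtain ⟨w, hw, hfw⟩ := h0
      refine ⟨insert w X, (Finset.card_insert_le _ _).trans (by omega), fun v => ?_⟩
      obtain ⟨x, hx, hvx⟩ := hspan v
      refine ⟨x + (f (v - x) / f w) • w, Submodule.add_mem _ ?_ (Submodule.smul_mem _ _ ?_), ?_⟩
      · exact Submodule.span_mono (by simp) hx
      · exact Submodule.subset_span (by simp)
      · intro g hg
        rw [← sub_sub, map_sub, map_smul, smul_eq_mul]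
        rcases Finset.mem_insert.1 hg with rfl | hg
        · field_simp
          ring
        · rw [hvx g hg, hw g hg, mul_zero, sub_zero]

theorem eq_zero_of_mem_span {X : Set V} (f : Dual F V) (h : ∀ x ∈ X, f x = 0) {x : V}
    (hx : x ∈ Submodule.span F X) : f x = 0 :=
  (Submodule.span_le.2 fun x hx => LinearMap.mem_ker.2 (h x hx) :
    Submodule.span F X ≤ LinearMap.ker f) hx

/-- Some matrix in the space of bilinear forms `B x` has an identity submatrix of size `q`,
after a change of basis, on the annihilators of `α` and `β`. -/
def HasDiag (B : V1 →ₗ[F] V2 →ₗ[F] V3 →ₗ[F] F) (α : Finset (Dual F V2))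
    (β : Finset (Dual F V3)) (q : ℕ) : Prop :=
  ∃ (x : V1) (u : Fin q → V2) (v : Fin q → V3), (∀ i, ∀ f ∈ α, f (u i) = 0) ∧
    (∀ i, ∀ f ∈ β, f (v i) = 0) ∧ ∀ i j, B x (u i) (v j) = if i = j then 1 else 0

variable (B : V1 →ₗ[F] V2 →ₗ[F] V3 →ₗ[F] F)

theorem HasDiag.extend {B : V1 →ₗ[F] V2 →ₗ[F] V3 →ₗ[F] F} {α : Finset (Dual F V2)}
    {β : Finset (Dual F V3)} {q : ℕ}
    {x : V1} {u : Fin q → V2} {v : Fin q → V3} (hu : ∀ i, ∀ f ∈ α, f (u i) = 0)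
    (hv : ∀ i, ∀ f ∈ β, f (v i) = 0) (huv : ∀ i j, B x (u i) (v j) = if i = j then 1 else 0)
    {s : V2} {t : V3} (hs : ∀ f ∈ α, f s = 0) (ht : ∀ f ∈ β, f t = 0)
    (hsv : ∀ j, B x s (v j) = 0) (hut : ∀ i, B x (u i) t = 0) (hst : B x s t ≠ 0) :
    HasDiag B α β (q + 1) := by
  refine ⟨x, Fin.cons ((B x s t)⁻¹ • s) u, Fin.cons t v, ?_, ?_, ?_⟩
  · intro i
    cases i using Fin.cases with
    | zero => intro f hf; simp [hs f hf]
    | succ i => simpa using hu i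
  · intro i
    cases i using Fin.cases with
    | zero => simpa using ht
    | succ i => simpa using hv i
  · intro i j
    cases i using Fin.cases with
    | zero =>
      cases j using Fin.cases with
      | zero => simp [hst]
      | succ j => simp [hsv, (Fin.succ_ne_zero j).symm]
    | succ i =>
      cases j using Fin.cases with
      | zero => simp [hut, Fin.succ_ne_zero i]
      | succ j => simp [huv]

theorem not_hasDiag_of_maximal {α : Finset (Dual F V2)} {β : Finset (Dual F V3)} {q : ℕ}
    (hmax : ¬ HasDiag B α β (q + 2)) {x : V1} {u : Fin (q + 1) → V2} {v : Fin (q + 1) → V3}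
    (hu : ∀ i, ∀ f ∈ α, f (u i) = 0)
    (hv : ∀ i, ∀ f ∈ β, f (v i) = 0) (huv : ∀ i j, B x (u i) (v j) = if i = j then 1 else 0)
    {x' : V1} {u' : Fin (q + 1) → V2} {v' : Fin (q + 1) → V3}
    (hu' : ∀ i, ∀ f ∈ α, f (u' i) = 0) (hv' : ∀ i, ∀ f ∈ β, f (v' i) = 0)
    (huv' : ∀ i j, B x' (u' i) (v' j) = if i = j then 1 else 0)
    (hu'v : ∀ i j, B x (u' i) (v j) = 0) (huv'0 : ∀ i j, B x (u i) (v' j) = 0) : False := by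
  have h1 : ∀ k l, B x (u' k) (v' l) = 0 := fun k l => by
    by_contra h
    exact hmax (HasDiag.extend hu hv huv (hu' k) (hv' l) (hu'v k) (fun i => huv'0 i l) h)
  let U : Fin (q + 1) → V2 := fun i => u i - ∑ k, B x' (u i) (v' k) • u' k
  let W : Fin (q + 1) → V3 := fun j => v j - ∑ k, B x' (u' k) (v j) • v' k
  have hU : ∀ i, ∀ f ∈ α, f (U i) = 0 := fun i f hf => by
    simp [U, hu i f hf, hu' _ f hf]
  have hW : ∀ i, ∀ f ∈ β, f (W i) = 0 := fun i f hf => by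
    simp [W, hv i f hf, hv' _ f hf]
  have hUv' : ∀ i j, B x' (U i) (v' j) = 0 := fun i j => by
    simp [U, huv', LinearMap.sum_apply]
  have hu'W : ∀ i j, B x' (u' i) (W j) = 0 := fun i j => by
    simp [W, huv']
  have hxu'W : ∀ i j, B x (u' i) (W j) = 0 := fun i j => by
    simp [W, hu'v, h1]
  have hxUv' : ∀ i j, B x (U i) (v' j) = 0 := fun i j => by
    simp [U, huv'0, h1, LinearMap.sum_apply]
  have hxUW : ∀ i j, B x (U i) (W j) = if i = j then 1 else 0 := fun i j => by
    have : B x (U i) (W j) = B x (u i) (W j) := by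
      simp [U, hxu'W, LinearMap.sum_apply]
    rw [this]
    simp [W, huv, huv'0]
  have hx'UW : ∀ i j, B x' (U i) (W j) = 0 := fun i j => by
    by_contra h
    exact hmax (HasDiag.extend hu' hv' huv' (hU i) (hW j) (hUv' i) (fun k => hu'W k j) h)
  refine hmax (HasDiag.extend (x := x + x') (u := U) (v := W) hU hW (fun i j => ?_)
    (hu' 0) (hv' 0) (fun j => ?_) (fun i => ?_) ?_)
  · simp [hxUW, hx'UW]
  · simp [hxu'W, hu'W]
  · simp [hxUv', hUv']
  · simp [h1, huv']

/-- A linear space of bilinear forms of bounded rank vanishes on a product of subspaces of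
bounded codimension. This holds over every field. -/
theorem exists_annihilators_of_not_hasDiag (r : ℕ) (α : Finset (Dual F V2))
    (β : Finset (Dual F V3)) (h : ¬ HasDiag B α β (r + 1)) :
    ∃ (α' : Finset (Dual F V2)) (β' : Finset (Dual F V3)), α'.card ≤ α.card + r ^ 2 ∧
      β'.card ≤ β.card + r ^ 2 ∧ ∀ x u v, (∀ f ∈ α', f u = 0) → (∀ f ∈ β', f v = 0) →
        B x u v = 0 := by
  classical
  induction r generalizing α β with
  | zero =>
    refine ⟨α, β, by simp, by simp, fun x u v hu hv => ?_⟩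
    by_contra hne
    exact h (HasDiag.extend (q := 0) (x := x) (u := Fin.elim0) (v := Fin.elim0)
      (fun i => i.elim0) (fun i => i.elim0) (fun i => i.elim0) hu hv (fun i => i.elim0)
      (fun i => i.elim0) hne)
  | succ r ih =>
    by_cases hd : HasDiag B α β (r + 1)
    · obtain ⟨x, u, v, hu, hv, huv⟩ := hd
      obtain ⟨α', β', hα', hβ', h'⟩ := ih (α ∪ Finset.univ.image fun i => (B x).flip (v i))
        (β ∪ Finset.univ.image fun i => B x (u i)) (by
          rintro ⟨x', u', v', hu', hv', huv'⟩
          refine not_hasDiag_of_maximal B h hu hv huv (x' := x') (u' := u') (v' := v')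
            (fun i f hf => hu' i f (Finset.mem_union_left _ hf))
            (fun i f hf => hv' i f (Finset.mem_union_left _ hf)) huv' (fun i j => ?_)
            (fun i j => ?_)
          · simpa using hu' i ((B x).flip (v j)) (Finset.mem_union_right _ (by simp))
          · exact hv' j (B x (u i)) (Finset.mem_union_right _ (by simp)))
      have h1 := Finset.card_union_le α (Finset.univ.image fun i => (B x).flip (v i))
      have h2 := Finset.card_union_le β (Finset.univ.image fun i => B x (u i))
      have h3 := Finset.card_image_le (s := Finset.univ) (f := fun i => (B x).flip (v i))
      have h4 := Finset.card_image_le (s := Finset.univ) (f := fun i => B x (u i))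
      simp only [Finset.card_univ, Fintype.card_fin] at h3 h4
      exact ⟨α', β', by nlinarith, by nlinarith, h'⟩
    · obtain ⟨α', β', hα', hβ', h'⟩ := ih α β hd
      have hr : r ^ 2 ≤ (r + 1) ^ 2 := Nat.pow_le_pow_left (Nat.le_succ r) 2
      exact ⟨α', β', by omega, by omega, h'⟩

theorem finrank_le_of_not_hasDiag [FiniteDimensional F V3]
    (hB : ∀ w, (∀ x y, B x y w = 0) → w = 0) (r : ℕ)
    (h1 : ¬ HasDiag B ∅ ∅ (r + 1)) (h2 : ¬ HasDiag B.flip ∅ ∅ (r + 1)) :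
    finrank F V3 ≤ 2 * r ^ 2 + r ^ 4 := by
  classical
  obtain ⟨α, β, hα, hβ, h⟩ := exists_annihilators_of_not_hasDiag B r _ _ h1
  obtain ⟨α', β', hα', hβ', h'⟩ := exists_annihilators_of_not_hasDiag B.flip r _ _ h2
  obtain ⟨X, hX, hXs⟩ := exists_span_complement_annihilator α'
  obtain ⟨Y, hY, hYs⟩ := exists_span_complement_annihilator α
  simp only [Finset.card_empty, zero_add] at hα hβ hα' hβ'
  have hcard : (β ∪ β' ∪ Finset.image₂ (fun x y => B x y) X Y).card ≤ 2 * r ^ 2 + r ^ 4 := by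
    have e1 := Finset.card_union_le (β ∪ β') (Finset.image₂ (fun x y => B x y) X Y)
    have e2 := Finset.card_union_le β β'
    have e3 := Finset.card_image₂_le (fun x y => B x y) X Y
    have e4 : X.card * Y.card ≤ r ^ 2 * r ^ 2 := Nat.mul_le_mul (by omega) (by omega)
    have e5 : r ^ 4 = r ^ 2 * r ^ 2 := by ring
    omega
  refine le_trans (finrank_le_card_of_annihilator_eq_bot _ fun w hw => hB w fun x y => ?_) hcard
  obtain ⟨x0, hx0, hx⟩ := hXs x
  obtain ⟨y0, hy0, hy⟩ := hYs y
  have e1 : B (x - x0) y w = 0 := by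
    have := h' y (x - x0) w hx fun f hf => hw f (by simp [hf])
    simpa using this
  have e2 : B x0 (y - y0) w = 0 := h x0 (y - y0) w hy fun f hf => hw f (by simp [hf])
  have e3 : B x0 y0 w = 0 := by
    have : ∀ a ∈ X, B a y0 w = 0 := fun a ha =>
      eq_zero_of_mem_span ((B a).flip w)
        (fun b hb => hw (B a b) (Finset.mem_union_right _ (Finset.mem_image₂_of_mem ha hb))) hy0
    exact eq_zero_of_mem_span ((B.flip y0).flip w) this hx0
  simp only [map_sub, LinearMap.sub_apply] at e1 e2
  rw [sub_eq_zero.1 e1, sub_eq_zero.1 e2, e3]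

variable [FiniteDimensional F V1] [FiniteDimensional F V2]

/-- A family of functionals with no common zero contains the dual basis of some basis. -/
theorem exists_dual_system {γ : Type*} (g : γ → Dual F V)
    (hg : ∀ x, (∀ c, g c x = 0) → x = 0) (k : ℕ) (hk : k ≤ finrank F V) :
    ∃ (e : Fin k → V) (l : Fin k → γ), ∀ i j, g (l i) (e j) = if i = j then 1 else 0 := by
  classical
  induction k with
  | zero => exact ⟨Fin.elim0, Fin.elim0, fun i => i.elim0⟩
  | succ k ih =>
    obtain ⟨e, l, hel⟩ := ih (by omega)
    have : FiniteDimensional F V := FiniteDimensional.of_finrank_pos (by omega)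
    obtain ⟨x, hx, hx0⟩ : ∃ x, (∀ i, g (l i) x = 0) ∧ x ≠ 0 := by
      by_contra! h0
      have := finrank_le_card_of_annihilator_eq_bot (Finset.univ.image fun i => g (l i))
        fun v hv => h0 v fun i => hv _ (by simp)
      have h3 := Finset.card_image_le (s := Finset.univ) (f := fun i => g (l i))
      simp only [Finset.card_univ, Fintype.card_fin] at h3
      omega
    obtain ⟨c, hc⟩ : ∃ c, g c x ≠ 0 := by
      by_contra! h0
      exact hx0 (hg x h0)
    refine ⟨Fin.cons ((g c x)⁻¹ • x) fun i => e i - (g c (e i) / g c x) • x, Fin.cons c l, ?_⟩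
    intro i j
    cases i using Fin.cases with
    | zero =>
      cases j using Fin.cases with
      | zero => simp [hc]
      | succ j => simp [hc, (Fin.succ_ne_zero j).symm]
    | succ i =>
      cases j using Fin.cases with
      | zero => simp [hx, Fin.succ_ne_zero i]
      | succ j => simp [hx, hel]

theorem exists_ne_zero_of_annihilators (hB : ∀ u, (∀ x w, B x u w = 0) → u = 0)
    (α : Finset (Dual F V2)) (β : Finset (Dual F V3))
    (h : α.card + finrank F V1 * β.card < finrank F V2) :
    ∃ x u w, (∀ f ∈ α, f u = 0) ∧ (∀ f ∈ β, f w = 0) ∧ B x u w ≠ 0 := by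
  classical
  by_contra! h0
  obtain ⟨Z, hZ, hZs⟩ := exists_span_complement_annihilator β
  let e := finBasis F V1
  let Γ := Finset.image₂ (fun i z => (B (e i)).flip z) Finset.univ Z
  have hΓ : Γ.card ≤ finrank F V1 * Z.card := by
    simpa using Finset.card_image₂_le (fun i z => (B (e i)).flip z) Finset.univ Z
  have hle := finrank_le_card_of_annihilator_eq_bot (α ∪ Γ) fun u hu => hB u fun x w => ?_
  · have e1 := Finset.card_union_le α Γ
    have e2 := Nat.mul_le_mul_left (finrank F V1) hZ
    omega
  · obtain ⟨z, hz, hw⟩ := hZs w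
    have e1 : B x u (w - z) = 0 := h0 x u (w - z) (fun f hf => hu f (by simp [hf])) hw
    have e2 : B x u z = 0 := by
      have : ∀ b ∈ Z, B x u b = 0 := fun b hb => by
        refine eq_zero_of_mem_span (X := Set.range e) ((B.flip u).flip b) ?_ (by simp)
        rintro _ ⟨i, rfl⟩
        simpa using hu ((B (e i)).flip b) (Finset.mem_union_right _
          (Finset.mem_image₂_of_mem (Finset.mem_univ _) hb))
      exact eq_zero_of_mem_span (B x u) this hz
    rw [map_sub, e2, sub_zero] at e1
    exact e1

/-- Greedy construction of a long "diagonal" orthogonal to prescribed vectors. -/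
theorem exists_orthogonal_diagonal (hB : ∀ u, (∀ x w, B x u w = 0) → u = 0) (n s : ℕ)
    (h : (s + n) * (finrank F V1 + finrank F V1 ^ 2) < finrank F V2)
    (P : Finset V2) (Q : Finset V3) (hP : P.card ≤ s) (hQ : Q.card ≤ s) :
    ∃ (u : Fin n → V2) (v : Fin n → V3), (∀ i, ∃ x, B x (u i) (v i) ≠ 0) ∧
      (∀ i j, i ≠ j → ∀ x, B x (u i) (v j) = 0) ∧ (∀ i, ∀ q ∈ Q, ∀ x, B x (u i) q = 0) ∧
      ∀ i, ∀ p ∈ P, ∀ x, B x p (v i) = 0 := by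
  classical
  induction n generalizing s P Q with
  | zero => exact ⟨Fin.elim0, Fin.elim0, fun i => i.elim0, fun i => i.elim0, fun i => i.elim0,
      fun i => i.elim0⟩
  | succ n ih =>
    let e := finBasis F V1
    let α := Finset.image₂ (fun i q => (B (e i)).flip q) Finset.univ Q
    let β := Finset.image₂ (fun i p => B (e i) p) Finset.univ P
    have hα : α.card ≤ finrank F V1 * Q.card := by
      simpa using Finset.card_image₂_le (fun i q => (B (e i)).flip q) Finset.univ Q
    have hβ : β.card ≤ finrank F V1 * P.card := by
      simpa using Finset.card_image₂_le (fun i p => B (e i) p) Finset.univ P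
    obtain ⟨x, u0, v0, hu0, hv0, hne⟩ := exists_ne_zero_of_annihilators B hB α β (by
      refine lt_of_le_of_lt ?_ h
      have e1 := Nat.mul_le_mul_left (finrank F V1) hQ
      have e2 := Nat.mul_le_mul_left (finrank F V1) hP
      have e3 := Nat.mul_le_mul_left (finrank F V1) (hβ.trans e2)
      nlinarith [Nat.zero_le ((n + 1) * (finrank F V1 + finrank F V1 ^ 2))])
    have hu0' : ∀ q ∈ Q, ∀ x, B x u0 q = 0 := fun q hq x => by
      refine eq_zero_of_mem_span (X := Set.range e) ((B.flip u0).flip q) ?_ (by simp)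
      rintro _ ⟨i, rfl⟩
      simpa using hu0 ((B (e i)).flip q) (Finset.mem_image₂_of_mem (Finset.mem_univ _) hq)
    have hv0' : ∀ p ∈ P, ∀ x, B x p v0 = 0 := fun p hp x => by
      refine eq_zero_of_mem_span (X := Set.range e) ((B.flip p).flip v0) ?_ (by simp)
      rintro _ ⟨i, rfl⟩
      simpa using hv0 (B (e i) p) (Finset.mem_image₂_of_mem (Finset.mem_univ _) hp)
    obtain ⟨u, v, h1, h2, h3, h4⟩ := ih (s + 1) (by rwa [add_assoc, add_comm 1 n])
      (insert u0 P) (insert v0 Q)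
      ((Finset.card_insert_le _ _).trans (by omega)) ((Finset.card_insert_le _ _).trans (by omega))
    refine ⟨Fin.cons u0 u, Fin.cons v0 v, ?_, ?_, ?_, ?_⟩
    · intro i
      cases i using Fin.cases with
      | zero => exact ⟨x, hne⟩
      | succ i => simpa using h1 i
    · intro i j hij
      cases i using Fin.cases with
      | zero =>
        cases j using Fin.cases with
        | zero => exact absurd rfl hij
        | succ j => simpa using h4 j u0 (by simp)
      | succ i =>
        cases j using Fin.cases with
        | zero => simpa using h3 i v0 (by simp)
        | succ j => simpa using h2 i j (fun h => hij (by rw [h]))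
    · intro i q hq
      cases i using Fin.cases with
      | zero => exact hu0' q hq
      | succ i => simpa using h3 i q (by simp [hq])
    · intro i p hp
      cases i using Fin.cases with
      | zero => exact hv0' p hp
      | succ i => simpa using h4 i p (by simp [hp])

/-- The normal form used to diagonalize powers of a tensor with one short leg. -/
theorem exists_narrow_normal_form {d : ℕ} (hd : finrank F V1 = d) (hd0 : 0 < d)
    (hB1 : ∀ x, (∀ u w, B x u w = 0) → x = 0) (hB2 : ∀ u, (∀ x w, B x u w = 0) → u = 0)
    (n : ℕ) (h : (d + d * n) * (d + d ^ 2) < finrank F V2) :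
    ∃ (e : Fin d → V1) (p : Fin d → V2) (q : Fin d → V3) (l : Fin d) (u : Fin n → V2)
      (v : Fin n → V3), (∀ a b, B (e a) (p b) (q b) = if b = a then 1 else 0) ∧
      (∀ i, B (e l) (u i) (v i) ≠ 0) ∧ (∀ i j, i ≠ j → ∀ x, B x (u i) (v j) = 0) ∧
      (∀ i b x, B x (u i) (q b) = 0) ∧ ∀ i b x, B x (p b) (v i) = 0 := by
  classical
  obtain ⟨e, c, hec⟩ := exists_dual_system (fun c : V2 × V3 => (B.flip c.1).flip c.2)
    (fun x hx => hB1 x fun u w => hx (u, w)) d hd.ge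
  have hli : LinearIndependent F e := by
    rw [Fintype.linearIndependent_iff]
    intro g hg i
    have := congrArg (fun x => (B.flip (c i).1).flip (c i).2 x) hg
    simpa only [map_sum, map_smul, hec, smul_eq_mul, mul_ite, mul_one, mul_zero,
      Finset.sum_ite_eq, Finset.mem_univ, if_true, map_zero] using this
  have hspan : Submodule.span F (Set.range e) = ⊤ :=
    hli.span_eq_top_of_card_eq_finrank' (by simp [hd])
  obtain ⟨u, v, h1, h2, h3, h4⟩ := exists_orthogonal_diagonal B hB2 (d * n) d (by rwa [hd])
    (Finset.univ.image fun i => (c i).1) (Finset.univ.image fun i => (c i).2)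
    (Finset.card_image_le.trans (by simp)) (Finset.card_image_le.trans (by simp))
  have hl : ∀ i, ∃ l, B (e l) (u i) (v i) ≠ 0 := fun i => by
    by_contra! h0
    obtain ⟨x, hx⟩ := h1 i
    refine hx (eq_zero_of_mem_span (X := Set.range e) ((B.flip (u i)).flip (v i)) ?_
      (by simp [hspan]))
    rintro _ ⟨l, rfl⟩
    exact h0 l
  choose l hl using hl
  obtain ⟨l0, -, hl0⟩ := Finset.exists_le_card_fiber_of_mul_le_card_of_maps_to
    (s := Finset.univ) (t := Finset.univ) (f := l) (n := n) (fun _ _ => Finset.mem_univ _)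
    ⟨⟨0, hd0⟩, Finset.mem_univ _⟩ (by simp)
  obtain ⟨s, hs, hsn⟩ := Finset.exists_subset_card_eq hl0
  let ν := s.equivFinOfCardEq hsn
  refine ⟨e, fun i => (c i).1, fun i => (c i).2, l0, fun i => u (ν.symm i), fun i => v (ν.symm i),
    fun a b => hec b a, fun i => ?_, fun i j hij => ?_, fun i b x => ?_, fun i b x => ?_⟩
  · have := (Finset.mem_filter.1 (hs (ν.symm i).2)).2
    rw [← this]
    exact hl _
  · exact h2 _ _ fun h => hij (ν.symm.injective (Subtype.ext h))
  · exact h3 _ _ (by simp) x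
  · exact h4 _ _ (by simp) x

end LinearAlgebra

section Values

open Filter

theorem le_asympSliceRankInf_of_hasDiag {ι1 ι2 ι3 : Type*} [Fintype ι1] [Fintype ι2] [Fintype ι3]
    (T : ι1 → ι2 → ι3 → F) {N : ℕ} (hN : 0 < N) (h1 : HasDiag (tri T) ∅ ∅ (N ^ 3))
    (h2 : HasDiag (tri T).flip ∅ ∅ (N ^ 3)) : (N : ℝ) ≤ asympSliceRankInf T := by
  classical
  obtain ⟨x, u, v, -, -, h⟩ := h1
  obtain ⟨y, u', v', -, -, h'⟩ := h2
  simp only [LinearMap.flip_apply] at h'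
  refine le_asympSliceRankInf T one_pos ?_
  filter_upwards [eventually_ge_atTop 2] with m hm
  have hq : 0 < N ^ 3 := by positivity
  let k := m / 2
  have hk : k + k ≤ m := by omega
  let i0 : Fin (N ^ 3) := ⟨0, hq⟩
  let V1 (a : Fin k → Fin (N ^ 3)) (s : Fin m) : ι1 → F :=
    if s.1 < k then x else if hs : s.1 - k < k then u' (a ⟨s.1 - k, hs⟩) else x
  let V2 (b : Fin k → Fin (N ^ 3)) (s : Fin m) : ι2 → F :=
    if hs : s.1 < k then u (b ⟨s.1, hs⟩) else if s.1 - k < k then y else u i0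
  let V3 (c : Fin k → Fin (N ^ 3)) (s : Fin m) : ι3 → F :=
    if hs : s.1 < k then v (c ⟨s.1, hs⟩) else
      if hs : s.1 - k < k then v' (c ⟨s.1 - k, hs⟩) else v i0
  have key := card_le_sliceRank (T := kronPow T m) (Fin k → Fin (N ^ 3))
    (restricts_of_tri (fun a => pureVec (V1 a)) (fun b => pureVec (V2 b))
      (fun c => pureVec (V3 c)) fun a b c => by
        rw [tri_kronPow, diagTensor]
        split_ifs with habc
        · obtain ⟨rfl, rfl⟩ := habc
          refine Finset.prod_eq_one fun s _ => ?_
          by_cases hs : s.1 < k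
          · simp [V1, V2, V3, hs, h]
          · by_cases hs' : s.1 - k < k
            · simp [V1, V2, V3, hs, hs', h']
            · simp [V1, V2, V3, hs, hs', h]
        · by_cases hbc : b = c
          · obtain ⟨t, ht⟩ := Function.ne_iff.1 fun hac : a = c => habc ⟨hac.trans hbc.symm, hbc⟩
            refine Finset.prod_eq_zero (Finset.mem_univ (⟨k + t, by omega⟩ : Fin m)) ?_
            simp [V1, V2, V3, h', ht]
          · obtain ⟨t, ht⟩ := Function.ne_iff.1 hbc
            refine Finset.prod_eq_zero (Finset.mem_univ (⟨t, by omega⟩ : Fin m)) ?_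
            simp [V1, V2, V3, h, ht])
  rw [Fintype.card_fun, Fintype.card_fin, Fintype.card_fin, ← pow_mul] at key
  have h3 : N ^ m ≤ N ^ (3 * k) := Nat.pow_le_pow_right hN (by omega)
  rw [one_mul]
  exact_mod_cast h3.trans key

/-- A popular symbol accounts for at least a `1 / d` fraction of all words. -/
theorem pow_le_mul_card_popular {d : ℕ} (l : Fin d) (m : ℕ) :
    d ^ m ≤ d * Fintype.card
      {x : Fin m → Fin d // m ≤ d * (Finset.univ.filter fun s => x s = l).card} := by
  have hsurj : Function.Surjective
      fun p : Fin d × {x : Fin m → Fin d // m ≤ d * (Finset.univ.filter fun s => x s = l).card} =>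
        fun s => Equiv.swap l p.1 (p.2.1 s) := by
    intro x
    obtain ⟨j, hj⟩ : ∃ j, m ≤ d * (Finset.univ.filter fun s => x s = j).card := by
      by_contra! hlt
      have hd : 0 < d := l.pos
      have h1 := Finset.card_eq_sum_card_fiberwise (f := x) (s := Finset.univ) (t := Finset.univ)
        (fun _ _ => Finset.mem_coe.2 (Finset.mem_univ _))
      have h2 : ∑ j : Fin d, d * (Finset.univ.filter fun s => x s = j).card < ∑ _j : Fin d, m :=
        Finset.sum_lt_sum_of_nonempty ⟨l, Finset.mem_univ _⟩ fun j _ => hlt j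
      rw [← Finset.mul_sum, ← h1] at h2
      simp at h2
    refine ⟨(j, ⟨fun s => Equiv.swap l j (x s), ?_⟩), funext fun s => by simp⟩
    rwa [Finset.filter_congr fun s _ =>
      show Equiv.swap l j (x s) = l ↔ x s = j by
        rw [Equiv.swap_apply_eq_iff, Equiv.swap_apply_left]]
  simpa using Fintype.card_le_of_surjective _ hsurj

/-- A square matrix is invertible if it has nonzero diagonal and its off-diagonal support
strictly increases a weight. -/
theorem isUnit_of_support_weight {κ : Type*} [Fintype κ] [DecidableEq κ] (M : Matrix κ κ F)
    (w : κ → ℕ) (h : ∀ a, M a a ≠ 0) (hw : ∀ a b, a ≠ b → M a b ≠ 0 → w a < w b) : IsUnit M := by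
  classical
  rw [← Matrix.mulVec_injective_iff_isUnit]
  refine (injective_iff_map_eq_zero M.mulVecLin).2 fun g hg => ?_
  by_contra hne
  obtain ⟨i, hi⟩ := Function.ne_iff.1 hne
  obtain ⟨a, ha, hmax⟩ := (Finset.univ.filter fun i => g i ≠ 0).exists_max_image w
    ⟨i, by simpa using hi⟩
  have h0 := congrFun hg a
  rw [Matrix.mulVecLin_apply, Matrix.mulVec, dotProduct, Finset.sum_eq_single a] at h0
  · exact (Finset.mem_filter.1 ha).2 (by simpa [h a] using h0)
  · intro b _ hba
    by_contra hb
    have := hw a b hba.symm (left_ne_zero_of_mul hb)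
    exact absurd (hmax b (by simpa using right_ne_zero_of_mul hb)) (by omega)
  · simp

theorem card_le_sliceRank_of_matrix {ι1 ι2 ι3 : Type*} [Fintype ι1] [Fintype ι2] [Fintype ι3]
    {T : ι1 → ι2 → ι3 → F} {κ : Type*} [Fintype κ] [DecidableEq κ] (M : Matrix κ κ F)
    (hM : IsUnit M) (h : Restricts T fun a b c => if b = c then M a b else 0) :
    Fintype.card κ ≤ sliceRank T := by
  refine le_trans (card_le_sliceRank κ ?_) (sliceRank_mono h)
  refine ⟨(M⁻¹ : Matrix κ κ F), (1 : Matrix κ κ F), (1 : Matrix κ κ F), fun a b c => ?_⟩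
  have h1 : (M⁻¹ * M) a b = (1 : Matrix κ κ F) a b := by
    rw [Matrix.nonsing_inv_mul _ ((Matrix.isUnit_iff_isUnit_det _).1 hM)]
  rw [Matrix.mul_apply] at h1
  by_cases hbc : b = c
  · subst hbc
    simpa [Matrix.one_apply, diagTensor] using h1.symm
  · simp [Matrix.one_apply, diagTensor, hbc]

theorem le_asympSliceRankInf_of_narrow {d : ℕ} {ι2 ι3 : Type*} [Fintype ι2] [Fintype ι3]
    (T : Fin d → ι2 → ι3 → F) (hT1 : ∀ x, (∀ u w, tri T x u w = 0) → x = 0)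
    (hT2 : ∀ u, (∀ x w, tri T x u w = 0) → u = 0)
    (h : (d + d * d ^ d) * (d + d ^ 2) < Fintype.card ι2) : (d : ℝ) ≤ asympSliceRankInf T := by
  classical
  rcases Nat.eq_zero_or_pos d with rfl | hd
  · exact le_asympSliceRankInf T one_pos
      ((eventually_ne_atTop 0).mono fun m hm => by simp [hm])
  obtain ⟨e, p, q, l, u, v, h1, h2, h3, h4, h5⟩ := exists_narrow_normal_form (tri T)
    (d := d) (by simp) hd hT1 hT2 (d ^ d) (by simpa using h)
  refine le_asympSliceRankInf T (c := d) (by exact_mod_cast hd) (Eventually.of_forall fun m => ?_)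
  let X := {x : Fin m → Fin d // m ≤ d * (Finset.univ.filter fun s => x s = l).card}
  let E (x : Fin m → Fin d) : Finset (Fin m) := Finset.univ.filter fun s => x s = l
  have hφ : ∀ A : Finset (Fin m), ∃ φ : (Fin m → Fin d) → Fin m → Fin (d ^ d),
      m ≤ d * A.card → ∀ b c, (∀ s ∈ A, φ b s = φ c s) → b = c := by
    intro A
    by_cases hA : m ≤ d * A.card
    · obtain ⟨φ⟩ : Nonempty ((Fin m → Fin d) ↪ (A → Fin (d ^ d))) := by
        rw [Function.Embedding.nonempty_iff_card_le]
        simp only [Fintype.card_fun, Fintype.card_fin, Fintype.card_coe, ← pow_mul]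
        exact Nat.pow_le_pow_right hd hA
      refine ⟨fun b s => if hs : s ∈ A then φ b ⟨s, hs⟩ else ⟨0, by positivity⟩,
        fun _ b c hbc => φ.injective (funext fun s => ?_)⟩
      simpa using hbc s.1 s.2
    · exact ⟨fun _ _ => ⟨0, by positivity⟩, fun h => absurd h hA⟩
  choose φ hφ using hφ
  let V2 (x : Fin m → Fin d) (s : Fin m) := if x s = l then u (φ (E x) x s) else p (x s)
  let V3 (x : Fin m → Fin d) (s : Fin m) := if x s = l then v (φ (E x) x s) else q (x s)
  let M : Matrix X X F := fun a b => ∏ s, tri T (e (a.1 s)) (V2 b.1 s) (V3 b.1 s)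
  have hsupp : ∀ a b : X, M a b ≠ 0 → ∀ s, b.1 s ≠ l → a.1 s = b.1 s := by
    intro a b hab s hs
    by_contra hne
    refine hab (Finset.prod_eq_zero (Finset.mem_univ s) ?_)
    simp [V2, V3, hs, h1, Ne.symm hne]
  have hM : IsUnit M := by
    refine isUnit_of_support_weight M (fun x => (E x.1).card) (fun a => ?_) fun a b hne hab => ?_
    · refine Finset.prod_ne_zero_iff.2 fun s _ => ?_
      by_cases hs : a.1 s = l
      · simp [V2, V3, hs, h2]
      · simp [V2, V3, hs, h1]
    · have hs := hsupp a b hab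
      refine Finset.card_lt_card (Finset.ssubset_iff_subset_ne.2 ⟨fun s => ?_, fun heq => ?_⟩)
      · simp only [E, Finset.mem_filter, Finset.mem_univ, true_and]
        intro has
        by_contra hbs
        exact hbs ((hs s hbs).symm.trans has)
      · refine hne (Subtype.ext (funext fun s => ?_))
        by_cases hbs : b.1 s = l
        · have : s ∈ E a.1 := heq ▸ by simp [E, hbs]
          rw [hbs]
          simpa [E] using this
        · exact hs s hbs
  have key := card_le_sliceRank_of_matrix (T := kronPow T m) M hM
    (restricts_of_tri (fun a => pureVec fun s => e (a.1 s)) (fun b => pureVec (V2 b.1))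
      (fun c => pureVec (V3 c.1)) fun a b c => by
        rw [tri_kronPow]
        split_ifs with hbc
        · rw [← hbc]
        · by_contra hne
          replace hne := Finset.prod_ne_zero_iff.1 hne
          have hE : ∀ s, b.1 s = l ↔ c.1 s = l := fun s => by
            have := hne s (Finset.mem_univ s)
            by_cases hb : b.1 s = l <;> by_cases hc : c.1 s = l <;>
              simp [V2, V3, hb, hc, h4, h5] at this ⊢
          have hE' : E b.1 = E c.1 := Finset.filter_congr fun s _ => hE s
          refine hbc (Subtype.ext (hφ (E b.1) b.2 _ _ fun s hs => ?_))
          have hbs : b.1 s = l := (Finset.mem_filter.1 hs).2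
          by_contra hne'
          refine hne s (Finset.mem_univ s) ?_
          simp only [V2, V3, hbs, (hE s).1 hbs, if_true]
          exact h3 _ _ (by rwa [← hE']) _)
  have := (pow_le_mul_card_popular l m).trans (Nat.mul_le_mul_left d key)
  exact_mod_cast this

end Values

section Nondegenerate

variable {n1 n2 n3 : ℕ}

/-- Every nonzero vector acts nontrivially in each leg of the tensor. -/
def Nondegenerate (T : Fin n1 → Fin n2 → Fin n3 → F) : Prop :=
  (∀ x, (∀ y z, tri T x y z = 0) → x = 0) ∧ (∀ y, (∀ x z, tri T x y z = 0) → y = 0) ∧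
    ∀ z, (∀ x y, tri T x y z = 0) → z = 0

theorem Nondegenerate.swap12 {T : Fin n1 → Fin n2 → Fin n3 → F} (h : Nondegenerate T) :
    Nondegenerate fun j i k => T i j k := by
  obtain ⟨h1, h2, h3⟩ := h
  simp only [Nondegenerate, tri_swap12]
  exact ⟨h2, h1, fun z hz => h3 z fun x y => hz y x⟩

theorem Nondegenerate.swap23 {T : Fin n1 → Fin n2 → Fin n3 → F} (h : Nondegenerate T) :
    Nondegenerate fun i k j => T i j k := by
  obtain ⟨h1, h2, h3⟩ := h
  simp only [Nondegenerate, tri_swap23]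
  exact ⟨fun x hx => h1 x fun y z => hx z y, h3, h2⟩

/-- A linear dependency between slices allows one of them to be dropped. -/
theorem exists_drop_slice (T : Fin n1 → Fin n2 → Fin n3 → F) {x : Fin n1 → F} (hx0 : x ≠ 0)
    (hx : ∀ y z, tri T x y z = 0) : ∃ n < n1, ∃ f : Fin n → Fin n1,
      asympSliceRankInf (fun i => T (f i)) = asympSliceRankInf T := by
  obtain ⟨i0, hi0⟩ := Function.ne_iff.1 hx0
  rcases n1 with _ | n
  · exact i0.elim0
  refine ⟨n, Nat.lt_succ_self n, i0.succAbove, asympSliceRankInf_congr ?_ ?_⟩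
  · have hi0 : x i0 ≠ 0 := hi0
    refine restricts_of_tri (fun a i => (if a = i0.succAbove i then 1 else 0) -
      if a = i0 then x (i0.succAbove i) / x i0 else 0) (fun b => Pi.single b 1)
      (fun c => Pi.single c 1) fun a b c => ?_
    have h0 := hx (Pi.single b 1) (Pi.single c 1)
    simp only [tri_apply, Pi.single_apply, mul_ite, mul_one, mul_zero, ite_mul, zero_mul,
      Finset.sum_ite_eq', Finset.mem_univ, if_true] at h0 ⊢
    rw [Fin.sum_univ_succAbove _ i0] at h0
    rcases Fin.eq_self_or_eq_succAbove i0 a with rfl | ⟨a', rfl⟩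
    · simp only [(Fin.succAbove_ne _ _).symm, if_false, if_true, zero_sub, neg_mul,
        Finset.sum_neg_distrib, div_mul_eq_mul_div, ← Finset.sum_div]
      rw [← neg_div, div_eq_iff hi0]
      linear_combination -h0
    · simp [Fin.succAbove_ne]
  · exact restricts_of_tri (fun a => Pi.single (i0.succAbove a) 1) (fun b => Pi.single b 1)
      (fun c => Pi.single c 1) fun a b c => tri_single _ _ _ _

theorem exists_nondegenerate (S : Set F) (T : Fin n1 → Fin n2 → Fin n3 → F)
    (hT : ∀ i j k, T i j k ∈ S) : ∃ (m1 m2 m3 : ℕ) (T' : Fin m1 → Fin m2 → Fin m3 → F),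
      (∀ i j k, T' i j k ∈ S) ∧ asympSliceRankInf T = asympSliceRankInf T' ∧
        Nondegenerate T' := by
  induction hn : n1 + n2 + n3 using Nat.strong_induction_on generalizing n1 n2 n3 with
  | _ n ih =>
    by_cases hnd : Nondegenerate T
    · exact ⟨n1, n2, n3, T, hT, rfl, hnd⟩
    rw [Nondegenerate] at hnd
    by_cases h1 : ∀ x, (∀ y z, tri T x y z = 0) → x = 0
    · by_cases h2 : ∀ y, (∀ x z, tri T x y z = 0) → y = 0
      · have h3 : ¬ ∀ z, (∀ x y, tri T x y z = 0) → z = 0 := fun h3 => hnd ⟨h1, h2, h3⟩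
        push Not at h3
        obtain ⟨z, hz, hz0⟩ := h3
        obtain ⟨m, hm, f, hf⟩ := exists_drop_slice (fun k i j => T i j k) hz0 fun x y => by
          rw [tri_swap12 (fun i k j => T i j k), tri_swap23]
          exact hz x y
        obtain ⟨m1, m2, m3, T', hT', hv, hnd'⟩ := ih (n1 + n2 + m) (by omega)
          (fun i j k => T i j (f k)) (fun i j k => hT _ _ _) rfl
        refine ⟨m1, m2, m3, T', hT', ?_, hnd'⟩
        rw [← hv, ← asympSliceRankInf_swap23 T, ← asympSliceRankInf_swap12 fun i k j => T i j k,
          ← hf, asympSliceRankInf_swap12 fun i k j => T i j (f k),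
          asympSliceRankInf_swap23 fun i j k => T i j (f k)]
      · push Not at h2
        obtain ⟨y, hy, hy0⟩ := h2
        obtain ⟨m, hm, f, hf⟩ := exists_drop_slice (fun j i k => T i j k) hy0 fun x z => by
          rw [tri_swap12]
          exact hy x z
        obtain ⟨m1, m2, m3, T', hT', hv, hnd'⟩ := ih (n1 + m + n3) (by omega)
          (fun i j k => T i (f j) k) (fun i j k => hT _ _ _) rfl
        refine ⟨m1, m2, m3, T', hT', ?_, hnd'⟩
        rw [← hv, ← asympSliceRankInf_swap12 T, ← hf,
          asympSliceRankInf_swap12 fun i j k => T i (f j) k]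
    · push Not at h1
      obtain ⟨x, hx, hx0⟩ := h1
      obtain ⟨m, hm, f, hf⟩ := exists_drop_slice T hx0 hx
      obtain ⟨m1, m2, m3, T', hT', hv, hnd'⟩ := ih (m + n2 + n3) (by omega)
        (fun i j k => T (f i) j k) (fun i j k => hT _ _ _) rfl
      exact ⟨m1, m2, m3, T', hT', hf.symm.trans hv, hnd'⟩

end Nondegenerate

section Finiteness

variable {n1 n2 n3 : ℕ}

theorem hasDiag_tri_swap23 (T : Fin n1 → Fin n2 → Fin n3 → F) {q : ℕ}
    (h : HasDiag (tri fun i k j => T i j k) ∅ ∅ q) : HasDiag (tri T) ∅ ∅ q := by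
  obtain ⟨x, u, v, -, -, huv⟩ := h
  refine ⟨x, v, u, by simp, by simp, fun i j => ?_⟩
  rw [← tri_swap23, huv]
  simp only [eq_comm]

theorem flip_tri (T : Fin n1 → Fin n2 → Fin n3 → F) :
    (tri T).flip = tri fun j i k => T i j k := by
  refine LinearMap.ext fun y => LinearMap.ext fun x => LinearMap.ext fun z => ?_
  rw [tri_swap12, LinearMap.flip_apply]

theorem exists_narrow_leg (T : Fin n1 → Fin n2 → Fin n3 → F) (hT : Nondegenerate T) {N r : ℕ}
    (hN : 0 < N) (hr : r + 1 = N ^ 3) (hv : asympSliceRankInf T < N) :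
    n1 ≤ 2 * r ^ 2 + r ^ 4 ∨ n2 ≤ 2 * r ^ 2 + r ^ 4 ∨ n3 ≤ 2 * r ^ 2 + r ^ 4 := by
  have hle : ∀ {m1 m2 m3 : ℕ} (T : Fin m1 → Fin m2 → Fin m3 → F), Nondegenerate T →
      ¬ HasDiag (tri T) ∅ ∅ (r + 1) → ¬ HasDiag (tri fun j i k => T i j k) ∅ ∅ (r + 1) →
      m3 ≤ 2 * r ^ 2 + r ^ 4 := fun T hT h1 h2 => by
    simpa using finrank_le_of_not_hasDiag (tri T) hT.2.2 r h1 (by rwa [flip_tri])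
  have hex : ∀ {m1 m2 m3 : ℕ} (T : Fin m1 → Fin m2 → Fin m3 → F), asympSliceRankInf T < N →
      HasDiag (tri T) ∅ ∅ (r + 1) → ¬ HasDiag (tri fun j i k => T i j k) ∅ ∅ (r + 1) :=
    fun T hv h1 h2 => by
      rw [hr] at h1 h2
      exact absurd hv (le_asympSliceRankInf_of_hasDiag T hN h1 (by rwa [flip_tri])).not_gt
  have hv2 : asympSliceRankInf (fun i k j => T i j k) < N := by rwa [asympSliceRankInf_swap23]
  have hv1 : asympSliceRankInf (fun j k i => T i j k) < N := by
    rwa [asympSliceRankInf_swap23 fun j i k => T i j k, asympSliceRankInf_swap12]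
  have a3 := hle T hT
  have a2 := hle (fun i k j => T i j k) hT.swap23
  have a1 := hle (fun j k i => T i j k) hT.swap12.swap23
  have b3 := hex T hv
  have b2 := hex _ hv2
  have b1 := hex _ hv1
  have e1 : HasDiag (tri T) ∅ ∅ (r + 1) ↔ HasDiag (tri fun i k j => T i j k) ∅ ∅ (r + 1) :=
    ⟨hasDiag_tri_swap23 fun i k j => T i j k, hasDiag_tri_swap23 T⟩
  have e2 : HasDiag (tri fun j i k => T i j k) ∅ ∅ (r + 1) ↔
      HasDiag (tri fun j k i => T i j k) ∅ ∅ (r + 1) :=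
    ⟨hasDiag_tri_swap23 fun j k i => T i j k, hasDiag_tri_swap23 fun j i k => T i j k⟩
  have e3 : HasDiag (tri fun k i j => T i j k) ∅ ∅ (r + 1) ↔
      HasDiag (tri fun k j i => T i j k) ∅ ∅ (r + 1) :=
    ⟨hasDiag_tri_swap23 fun k j i => T i j k, hasDiag_tri_swap23 fun k i j => T i j k⟩
  rw [← e1] at a2 b2
  rw [← e2, ← e3] at a1 b1
  by_cases d1 : HasDiag (tri T) ∅ ∅ (r + 1)
  · exact Or.inl (a1 (b3 d1) (b2 d1))
  · by_cases d2 : HasDiag (tri fun j i k => T i j k) ∅ ∅ (r + 1)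
    · exact Or.inr (Or.inl (a2 d1 (b1 d2)))
    · exact Or.inr (Or.inr (a3 d1 d2))

theorem eq_or_le_of_narrow (T : Fin n1 → Fin n2 → Fin n3 → F) (hT : Nondegenerate T) :
    asympSliceRankInf T = n1 ∨ n2 ≤ (n1 + n1 * n1 ^ n1) * (n1 + n1 ^ 2) ∧
      n3 ≤ (n1 + n1 * n1 ^ n1) * (n1 + n1 ^ 2) := by
  by_contra! hcon
  obtain ⟨hne, h⟩ := hcon
  have hle : asympSliceRankInf T ≤ n1 := by simpa using asympSliceRankInf_le_card T
  refine hne (hle.antisymm ?_)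
  by_cases h2 : n2 ≤ (n1 + n1 * n1 ^ n1) * (n1 + n1 ^ 2)
  · rw [← asympSliceRankInf_swap23 T]
    exact le_asympSliceRankInf_of_narrow _ hT.swap23.1 hT.swap23.2.1 (by simpa using h h2)
  · exact le_asympSliceRankInf_of_narrow _ hT.1 hT.2.1 (by simpa using h2)

theorem exists_bound_of_asympSliceRankInf_lt (N : ℕ) (hN : 0 < N) : ∃ B : ℕ,
    ∀ {n1 n2 n3 : ℕ} (T : Fin n1 → Fin n2 → Fin n3 → F), Nondegenerate T →
      asympSliceRankInf T < N →
        (∃ k ≤ B, asympSliceRankInf T = k) ∨ n1 ≤ B ∧ n2 ≤ B ∧ n3 ≤ B := by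
  obtain ⟨r, hr⟩ : ∃ r, r + 1 = N ^ 3 := ⟨N ^ 3 - 1, Nat.sub_add_cancel (Nat.one_le_pow _ _ hN)⟩
  let c := 2 * r ^ 2 + r ^ 4
  let f : ℕ → ℕ := fun d => (d + d * d ^ d) * (d + d ^ 2)
  refine ⟨c + (Finset.range (c + 1)).sup f, fun {n1 n2 n3} T hT hv => ?_⟩
  have hf : ∀ d ≤ c, f d ≤ (Finset.range (c + 1)).sup f := fun d hd =>
    Finset.le_sup (by simpa [Nat.lt_succ_iff] using hd)
  have key : ∀ {m1 m2 m3 : ℕ} (T' : Fin m1 → Fin m2 → Fin m3 → F), Nondegenerate T' →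
      asympSliceRankInf T' = asympSliceRankInf T → m1 ≤ c →
      (∃ k ≤ c + (Finset.range (c + 1)).sup f, asympSliceRankInf T = k) ∨
        m1 ≤ c + (Finset.range (c + 1)).sup f ∧ m2 ≤ c + (Finset.range (c + 1)).sup f ∧
          m3 ≤ c + (Finset.range (c + 1)).sup f := by
    intro m1 m2 m3 T' hT' he hm
    rcases eq_or_le_of_narrow T' hT' with h | ⟨h2, h3⟩
    · exact Or.inl ⟨m1, by omega, he ▸ h⟩
    · have h2 : m2 ≤ f m1 := h2
      have h3 : m3 ≤ f m1 := h3
      have := hf m1 hm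
      exact Or.inr ⟨by omega, by omega, by omega⟩
  rcases exists_narrow_leg T hT hN hr hv with h | h | h
  · exact key T hT rfl h
  · refine (key _ hT.swap12 (asympSliceRankInf_swap12 T) h).imp_right ?_
    rintro ⟨h2, h1, h3⟩
    exact ⟨h1, h2, h3⟩
  · refine (key _ hT.swap23.swap12 ((asympSliceRankInf_swap12 fun i k j => T i j k).trans
      (asympSliceRankInf_swap23 T)) h).imp_right ?_
    rintro ⟨h3, h1, h2⟩
    exact ⟨h1, h2, h3⟩

theorem finite_asympSliceRankInf_values_lt {S : Set F} (hS : S.Finite) (N : ℕ) (hN : 0 < N) :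
    ({y : ℝ | ∃ (n1 n2 n3 : ℕ) (T : Fin n1 → Fin n2 → Fin n3 → F),
      (∀ i j k, T i j k ∈ S) ∧ y = asympSliceRankInf T} ∩ Set.Iio (N : ℝ)).Finite := by
  obtain ⟨B, hB⟩ := exists_bound_of_asympSliceRankInf_lt (F := F) N hN
  have hfin : ∀ n1 n2 n3 : ℕ,
      {T : Fin n1 → Fin n2 → Fin n3 → F | ∀ i j k, T i j k ∈ S}.Finite := fun n1 n2 n3 =>
    Set.Finite.pi' fun _ => Set.Finite.pi' fun _ => Set.Finite.pi' fun _ => hS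
  refine Set.Finite.subset (((Set.finite_Iic B).image (Nat.cast : ℕ → ℝ)).union
    ((Set.finite_Iic B).biUnion fun n1 _ => (Set.finite_Iic B).biUnion fun n2 _ =>
      (Set.finite_Iic B).biUnion fun n3 _ => (hfin n1 n2 n3).image asympSliceRankInf)) ?_
  rintro y ⟨⟨n1, n2, n3, T, hT, rfl⟩, hy⟩
  obtain ⟨m1, m2, m3, T', hT', he, hnd⟩ := exists_nondegenerate S T hT
  rw [he] at hy ⊢
  rcases hB T' hnd hy with ⟨k, hk, h⟩ | ⟨h1, h2, h3⟩
  · exact Or.inl ⟨k, hk, h.symm⟩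
  · refine Or.inr ?_
    simp only [Set.mem_iUnion]
    exact ⟨m1, h1, m2, h2, m3, h3, T', hT', rfl⟩

end Finiteness

/-- Over any field `F` and any finite coefficient set `S ⊆ F`, the set
of values of the (liminf) asymptotic slice rank on order-three tensors with
coefficients in `S` has no accumulation points. -/
theorem asympSliceRank_values_no_accumulation (F : Type*) [Field F]
    (S : Set F) (hS : S.Finite) :
    ∀ x : ℝ, ¬ AccPt x (Filter.principal
      {y : ℝ | ∃ (n1 n2 n3 : ℕ) (T : Fin n1 → Fin n2 → Fin n3 → F),
        (∀ i j k, T i j k ∈ S) ∧ y = asympSliceRankInf T}) := by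
  intro x hx
  obtain ⟨N, hN⟩ := exists_nat_gt x
  refine (finite_asympSliceRankInf_values_lt hS (N + 1) N.succ_pos).not_infinite ?_
  refine Set.Infinite.of_accPt (x := x) ?_
  rw [Set.inter_comm]
  exact hx.nhds_inter (Iio_mem_nhds (hN.trans (by push_cast; exact lt_add_one _)))

end Paper
end

section
/- Let F be any field, let S ⊆ F be a finite subset, and let k ∈ ℕ. Then the set of real numbers {R~(T) : T an order-k tensor over F of any format all of whose coefficients in the standard bases lie in S} has no accumulation points. -/
open scoped BigOperators

namespace Paper

variable {F : Type*} [Field F]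

/-- A sum of `r` products of (possibly zero) vectors has a rank decomposition of length at
most `r`. -/
lemma exists_rankOne_decomposition {k : ℕ} {ι : Fin k → Type*} {T : ((i : Fin k) → ι i) → F}
    {κ : Type*} [Fintype κ] (u : κ → (i : Fin k) → ι i → F)
    (hT : ∀ v, T v = ∑ t, ∏ i, u t i (v i)) :
    ∃ r ≤ Fintype.card κ, ∃ f : Fin r → (((i : Fin k) → ι i) → F),
      (∀ t, RankOne (f t)) ∧ T = ∑ t, f t := by
  classical
  let s : Finset κ := Finset.univ.filter fun t => ∀ i, u t i ≠ 0
  refine ⟨s.card, Finset.card_le_univ s, fun t v => ∏ i, u (s.equivFin.symm t) i (v i),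
    fun t => ⟨fun i => u (s.equivFin.symm t) i, ?_, fun v => rfl⟩, ?_⟩
  · exact (Finset.mem_filter.1 (s.equivFin.symm t).2).2
  · funext v
    rw [Finset.sum_apply, hT, Equiv.sum_comp s.equivFin.symm
      (fun t : s => ∏ i, u t i (v i)), Finset.sum_coe_sort s (fun t => ∏ i, u t i (v i))]
    refine (Finset.sum_subset (Finset.subset_univ s) fun t _ ht => ?_).symm
    obtain ⟨i, hi⟩ : ∃ i, u t i = 0 := by simpa [s] using ht
    exact Finset.prod_eq_zero (Finset.mem_univ i) (by rw [hi]; rfl)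

lemma tensorRank_le {k : ℕ} {ι : Fin k → Type*} {T : ((i : Fin k) → ι i) → F}
    {κ : Type*} [Fintype κ] (u : κ → (i : Fin k) → ι i → F)
    (hT : ∀ v, T v = ∑ t, ∏ i, u t i (v i)) : tensorRank T ≤ Fintype.card κ := by
  obtain ⟨r, hr, h⟩ := exists_rankOne_decomposition u hT
  exact (Nat.sInf_le h).trans hr

/-- In positive order every tensor is a sum of `tensorRank T` products of vectors. -/
lemma exists_decomposition_tensorRank {k : ℕ} [NeZero k] {ι : Fin k → Type*} [∀ i, Finite (ι i)]
    (T : ((i : Fin k) → ι i) → F) :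
    ∃ u : Fin (tensorRank T) → (i : Fin k) → ι i → F, ∀ v, T v = ∑ t, ∏ i, u t i (v i) := by
  classical
  have := fun i => Fintype.ofFinite (ι i)
  let u : ((i : Fin k) → ι i) → (i : Fin k) → ι i → F :=
    fun w i => Pi.single (w i) (if i = 0 then T w else 1)
  have hu : ∀ v, T v = ∑ w, ∏ i, u w i (v i) := by
    intro v
    rw [Finset.sum_eq_single v]
    · simp [u]
    · intro w _ hw
      obtain ⟨i, hi⟩ := Function.ne_iff.1 hw
      exact Finset.prod_eq_zero (Finset.mem_univ i) (Pi.single_eq_of_ne hi.symm _)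
    · simp
  obtain ⟨r, -, h⟩ := exists_rankOne_decomposition u hu
  obtain ⟨f, hf, hT⟩ := Nat.sInf_mem (s := {r : ℕ | ∃ f : Fin r → (((i : Fin k) → ι i) → F),
    (∀ t, RankOne (f t)) ∧ T = ∑ t, f t}) ⟨r, h⟩
  choose w _ hw using hf
  refine ⟨w, fun v => ?_⟩
  conv_lhs => rw [hT]
  rw [Finset.sum_apply]
  exact Finset.sum_congr rfl fun t _ => hw t v

/-- Pulling a tensor back along maps of index sets does not increase its rank. -/
lemma tensorRank_comp_le {k : ℕ} [NeZero k] {ι κ : Fin k → Type*} [∀ i, Finite (ι i)]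
    (T : ((i : Fin k) → ι i) → F) (π : (i : Fin k) → κ i → ι i) :
    tensorRank (fun v : (i : Fin k) → κ i => T fun i => π i (v i)) ≤ tensorRank T := by
  obtain ⟨u, hu⟩ := exists_decomposition_tensorRank T
  simpa using tensorRank_le (T := fun v : (i : Fin k) → κ i => T fun i => π i (v i))
    (fun t i a => u t i (π i a)) fun v => hu _

lemma asympRank_eq_of_comp {k : ℕ} [NeZero k] {ι κ : Fin k → Type*} [∀ i, Finite (ι i)]
    [∀ i, Finite (κ i)] {T : ((i : Fin k) → ι i) → F} {T' : ((i : Fin k) → κ i) → F}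
    (π : (i : Fin k) → ι i → κ i) (σ : (i : Fin k) → κ i → ι i)
    (hT : ∀ v, T v = T' fun i => π i (v i)) (hT' : ∀ v, T' v = T fun i => σ i (v i)) :
    asympRank T = asympRank T' := by
  have key (m : ℕ) : tensorRank (kronPowK T m) = tensorRank (kronPowK T' m) := by
    apply le_antisymm
    · have h : kronPowK T m = fun v => kronPowK T' m fun i s => π i (v i s) := by
        funext v
        exact Finset.prod_congr rfl fun s _ => hT _
      rw [h]
      exact tensorRank_comp_le (kronPowK T' m) fun i (w : Fin m → ι i) s => π i (w s)
    · have h : kronPowK T' m = fun v => kronPowK T m fun i s => σ i (v i s) := by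
        funext v
        exact Finset.prod_congr rfl fun s _ => hT' _
      rw [h]
      exact tensorRank_comp_le (kronPowK T m) fun i (w : Fin m → κ i) s => σ i (w s)
  simp only [asympRank, key]

/-- If a family `κ` of columns of the `i`-th flattening of `T` has a left inverse, then
`T^{⊠m}` has rank at least `|κ|^m`. -/
lemma pow_card_le_tensorRank_kronPowK {k : ℕ} [NeZero k] {ι : Fin k → Type*}
    [∀ i, Fintype (ι i)] (T : ((i : Fin k) → ι i) → F) (i : Fin k) {κ : Type*} [Fintype κ]
    [DecidableEq κ] (p : κ → (i : Fin k) → ι i) (B : κ → ι i → F)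
    (hB : ∀ x y, ∑ a, B x a * T (Function.update (p y) i a) = if x = y then 1 else 0) (m : ℕ) :
    Fintype.card κ ^ m ≤ tensorRank (kronPowK T m) := by
  classical
  obtain ⟨u, hu⟩ := exists_decomposition_tensorRank (kronPowK T m)
  let q (X : Fin m → κ) (j : Fin k) (s : Fin m) : ι j := p (X s) j
  let Bm : Matrix (Fin m → κ) (Fin m → ι i) F := Matrix.of fun X w => ∏ s, B (X s) (w s)
  let U : Matrix (Fin m → ι i) (Fin (tensorRank (kronPowK T m))) F :=
    Matrix.of fun w t => u t i w
  let V : Matrix (Fin (tensorRank (kronPowK T m))) (Fin m → κ) F :=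
    Matrix.of fun t X => ∏ j ∈ Finset.univ.erase i, u t j (q X j)
  have hUV (w : Fin m → ι i) (X : Fin m → κ) :
      (U * V) w X = ∏ s, T (Function.update (p (X s)) i (w s)) := by
    have h1 : kronPowK T m (Function.update (q X) i w) =
        ∏ s, T (Function.update (p (X s)) i (w s)) := by
      refine Finset.prod_congr rfl fun s _ => congrArg T (funext fun j => ?_)
      rcases eq_or_ne j i with rfl | hj
      · simp
      · simp [hj, q]
    rw [← h1, hu, Matrix.mul_apply]
    refine Finset.sum_congr rfl fun t _ => ?_
    rw [← Finset.mul_prod_erase _ _ (Finset.mem_univ i)]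
    simp only [U, V, Matrix.of_apply, Function.update_self]
    congr 1
    refine Finset.prod_congr rfl fun j hj => ?_
    rw [Function.update_of_ne (Finset.ne_of_mem_erase hj)]
  have hone : Bm * U * V = 1 := by
    ext X Y
    rw [Matrix.mul_assoc, Matrix.mul_apply]
    simp only [hUV, Bm, Matrix.of_apply, ← Finset.prod_mul_distrib]
    rw [← Fintype.prod_sum fun s a => B (X s) a * T (Function.update (p (Y s)) i a)]
    simp only [hB, Matrix.one_apply]
    rw [Finset.prod_ite_zero]
    simp [funext_iff]
  calc Fintype.card κ ^ m = (1 : Matrix (Fin m → κ) (Fin m → κ) F).rank := by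
        simp [Matrix.rank_one]
    _ = (Bm * U * V).rank := by rw [hone]
    _ ≤ (Bm * U).rank := Matrix.rank_mul_le_left _ _
    _ ≤ tensorRank (kronPowK T m) := by simpa using Matrix.rank_le_card_width (Bm * U)

lemma exists_dual_of_linearIndependent {α κ : Type*} [Fintype α] [DecidableEq κ]
    {v : κ → α → F} (hv : LinearIndependent F v) :
    ∃ B : κ → α → F, ∀ x y, ∑ a, B x a * v y a = if x = y then 1 else 0 := by
  classical
  obtain ⟨L, hL⟩ := (Finsupp.linearCombination F v).exists_leftInverse_of_injective
    (LinearMap.ker_eq_bot.2 hv)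
  refine ⟨fun x a => L (Pi.single a 1) x, fun x y => ?_⟩
  have h1 : L (v y) = Finsupp.single y 1 := by
    simpa using LinearMap.congr_fun hL (Finsupp.single y 1)
  have h2 : v y = ∑ a, v y a • (Pi.single a 1 : α → F) := by
    funext b
    simp [Finset.sum_apply, Pi.single_apply]
  have h3 : L (v y) x = ∑ a, L (Pi.single a 1) x * v y a := by
    conv_lhs => rw [h2]
    simp [map_sum, Finsupp.finsetSum_apply, mul_comm]
  rw [← h3, h1, Finsupp.single_apply]
  simp [eq_comm]

/-- The slices of `T` in direction `i` are told apart by at most `asympRank T` of their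
entries. -/
lemma exists_separating_columns {k : ℕ} [NeZero k] {ι : Fin k → Type*}
    [∀ i, Fintype (ι i)] (T : ((i : Fin k) → ι i) → F) (i : Fin k) :
    ∃ (d : ℕ) (p : Fin d → (i : Fin k) → ι i), (d : ℝ) ≤ asympRank T ∧
      ∀ a b, (∀ x, T (Function.update (p x) i a) = T (Function.update (p x) i b)) →
        ∀ v, T (Function.update v i a) = T (Function.update v i b) := by
  classical
  let c : ((i : Fin k) → ι i) → ι i → F := fun v a => T (Function.update v i a)
  obtain ⟨κ, p, hp, hspan, hli⟩ := exists_linearIndependent' F c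
  have := Fintype.ofInjective p hp
  obtain ⟨B, hB⟩ := exists_dual_of_linearIndependent hli
  let e := Fintype.equivFin κ
  refine ⟨Fintype.card κ, fun x => p (e.symm x), le_ciInf fun m => ?_, fun a b hab v => ?_⟩
  · have h : ((Fintype.card κ : ℝ)) ^ (m + 1) ≤ tensorRank (kronPowK T (m + 1)) := by
      exact_mod_cast pow_card_le_tensorRank_kronPowK T i p B hB (m + 1)
    calc (Fintype.card κ : ℝ)
        = ((Fintype.card κ : ℝ) ^ (m + 1)) ^ ((1 : ℝ) / (m + 1)) := by
          rw [one_div]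
          exact_mod_cast (Real.pow_rpow_inv_natCast (Nat.cast_nonneg _) m.succ_ne_zero).symm
      _ ≤ _ := Real.rpow_le_rpow (by positivity) h (by positivity)
  · have hmem : c v ∈ Submodule.span F (Set.range (c ∘ p)) := by
      rw [hspan]
      exact Submodule.subset_span ⟨v, rfl⟩
    have hle : Submodule.span F (Set.range (c ∘ p)) ≤ LinearMap.ker
        ((LinearMap.proj a : (ι i → F) →ₗ[F] F) - LinearMap.proj b) := by
      rw [Submodule.span_le]
      rintro _ ⟨x, rfl⟩
      simpa [sub_eq_zero, c] using hab (e x)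
    simpa [sub_eq_zero, c] using hle hmem

/-- Replacing every index by one with the same slice does not change the entries of `T`. -/
lemma apply_eq_of_slice_eq {R : Type*} {k : ℕ} {ι : Fin k → Type*}
    (T : ((i : Fin k) → ι i) → R)
    (ρ : (i : Fin k) → ι i → ι i)
    (hρ : ∀ i a v, T (Function.update v i (ρ i a)) = T (Function.update v i a))
    (v : (i : Fin k) → ι i) : T v = T fun i => ρ i (v i) := by
  classical
  have key (s : Finset (Fin k)) : T v = T fun i => if i ∈ s then ρ i (v i) else v i := by
    induction s using Finset.induction_on with
    | empty => simp
    | insert j s hj ih =>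
      have h := hρ j (v j) fun i => if i ∈ s then ρ i (v i) else v i
      rw [ih]
      convert h.symm using 2
      · funext i
        rcases eq_or_ne i j with rfl | hi
        · simp [hj]
        · simp [hi]
      · funext i
        rcases eq_or_ne i j with rfl | hi
        · simp
        · simp [hi]
  simpa using key Finset.univ

/-- A tensor with coefficients in a finite set has the same asymptotic rank as one, with the same
coefficients, whose format is bounded in terms of the asymptotic rank. -/
lemma exists_bounded_format {S : Set F} (hS : S.Finite) {k : ℕ} [NeZero k] {n : Fin k → ℕ}
    (T : ((i : Fin k) → Fin (n i)) → F) (hT : ∀ v, T v ∈ S) {C : ℕ} (hC : asympRank T ≤ C) :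
    ∃ (n' : Fin k → ℕ) (T' : ((i : Fin k) → Fin (n' i)) → F),
      (∀ i, n' i ≤ (S.ncard + 1) ^ C) ∧ (∀ v, T' v ∈ S) ∧ asympRank T = asympRank T' := by
  classical
  let slice (i : Fin k) (a : Fin (n i)) : ((i : Fin k) → Fin (n i)) → F :=
    fun v => T (Function.update v i a)
  let e (i : Fin k) := Fintype.equivFin (Set.range (slice i))
  let π (i : Fin k) (a : Fin (n i)) := e i ⟨slice i a, a, rfl⟩
  let σ (i : Fin k) (x : Fin (Fintype.card (Set.range (slice i)))) : Fin (n i) :=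
    ((e i).symm x).2.choose
  have hσ (i : Fin k) (x) : slice i (σ i x) = (e i).symm x := ((e i).symm x).2.choose_spec
  refine ⟨fun i => Fintype.card (Set.range (slice i)), fun v => T fun i => σ i (v i),
    fun i => ?_, fun v => hT _, asympRank_eq_of_comp π σ (fun v => ?_) fun v => rfl⟩
  · obtain ⟨d, p, hd, hp⟩ := exists_separating_columns T i
    have hdC : d ≤ C := by exact_mod_cast hd.trans hC
    have := hS.fintype
    let g (f : Set.range (slice i)) : Fin d → S := fun x => ⟨f.1 (p x), by
      obtain ⟨_, a, rfl⟩ := f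
      exact hT _⟩
    have hg : Function.Injective g := by
      rintro ⟨_, a, rfl⟩ ⟨_, b, rfl⟩ h
      refine Subtype.ext (funext (hp a b fun x => ?_))
      exact congrArg Subtype.val (congrFun h x)
    calc Fintype.card (Set.range (slice i)) ≤ Fintype.card (Fin d → S) :=
          Fintype.card_le_of_injective g hg
      _ = S.ncard ^ d := by
          rw [Fintype.card_fun, Fintype.card_fin, ← Nat.card_eq_fintype_card, Nat.card_coe_set_eq]
      _ ≤ (S.ncard + 1) ^ d := Nat.pow_le_pow_left (Nat.le_succ _) d
      _ ≤ (S.ncard + 1) ^ C := Nat.pow_le_pow_right (Nat.succ_pos _) hdC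
  · refine apply_eq_of_slice_eq T (fun i a => σ i (π i a)) (fun i a v => ?_) v
    have h : slice i (σ i (π i a)) = slice i a := by simp [hσ, π]
    exact congrFun h v

/-- Bounded formats and a finite coefficient set give finitely many asymptotic ranks. -/
lemma finite_asympRank_of_format_le {S : Set F} (hS : S.Finite) (k N : ℕ) :
    {y : ℝ | ∃ (n : Fin k → ℕ) (T : ((i : Fin k) → Fin (n i)) → F),
      (∀ i, n i ≤ N) ∧ (∀ v, T v ∈ S) ∧ y = asympRank T}.Finite := by
  have := hS.to_subtype
  have hfin : (⋃ n ∈ {n : Fin k → ℕ | ∀ i, n i ≤ N},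
      Set.range fun T : ((i : Fin k) → Fin (n i)) → S =>
        asympRank fun v => (T v : F)).Finite := by
    refine Set.Finite.biUnion ?_ fun n _ => Set.finite_range _
    exact (Set.finite_Iic fun _ => N).subset fun n hn => hn
  refine hfin.subset ?_
  rintro y ⟨n, T, hn, hT, rfl⟩
  exact Set.mem_biUnion (x := n) hn ⟨fun v => ⟨T v, hT v⟩, rfl⟩

/-- Over any field `F`, any finite coefficient set `S ⊆ F` and any
order `k`, the set of values of the asymptotic tensor rank on order-`k` tensors with
coefficients in `S` has no accumulation points. -/
theorem asympRank_values_no_accumulation (F : Type*) [Field F]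
    (S : Set F) (hS : S.Finite) (k : ℕ) :
    ∀ x : ℝ, ¬ AccPt x (Filter.principal
      {y : ℝ | ∃ (n : Fin k → ℕ) (T : ((i : Fin k) → Fin (n i)) → F),
        (∀ v, T v ∈ S) ∧ y = asympRank T}) := by
  intro x hx
  obtain ⟨C, hC⟩ := exists_nat_gt x
  refine Set.Infinite.of_accPt (hx.nhds_inter (Iio_mem_nhds hC))
    ((finite_asympRank_of_format_le hS k ((S.ncard + 1) ^ C)).subset ?_)
  rintro y ⟨hyC, n, T, hT, rfl⟩
  rcases Nat.eq_zero_or_pos k with rfl | hk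
  · exact ⟨n, T, fun i => i.elim0, hT, rfl⟩
  · have : NeZero k := ⟨hk.ne'⟩
    obtain ⟨n', T', hn', hT', h⟩ := exists_bounded_format hS T hT (le_of_lt hyC)
    exact ⟨n', T', hn', hT', h⟩

end Paper
end

section
/- Let T ∈ F^{n1} ⊗ F^{n2} ⊗ F^{n3} be a tensor over a field F and let A_1, …, A_c ∈ F^{n1×n2} be c of its 3-slices. If A_1, …, A_c are linearly independent and minrank(A_1, …, A_c) ≥ 2c(c−1), then the subrank satisfies Q(T) ≥ c. -/
open scoped BigOperators

namespace Paper

variable {F : Type*} [Field F]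

/-- If `T` restricts to `⟨r⟩`, then `r` is at most the first dimension of `T`. -/
theorem Restricts.unitTensor_le_card {ι1 ι2 ι3 : Type*} [Fintype ι1] [Fintype ι2] [Fintype ι3]
    {T : ι1 → ι2 → ι3 → F} {r : ℕ} (h : Restricts T (unitTensor F r)) :
    r ≤ Fintype.card ι1 := by
  obtain ⟨L1, L2, L3, h⟩ := h
  have hL : LinearIndependent F L1 := by
    rw [Fintype.linearIndependent_iff]
    intro g hg b
    have hz : ∀ i, ∑ a, g a * L1 a i = 0 := fun i => by
      simpa using congrFun hg i
    have hb : ∑ a, g a * unitTensor F r a b b = g b := by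
      simp [unitTensor]
    rw [← hb]
    simp_rw [h, Finset.mul_sum]
    rw [Finset.sum_comm]
    refine Finset.sum_eq_zero fun i _ => ?_
    rw [Finset.sum_comm]
    refine Finset.sum_eq_zero fun j _ => ?_
    rw [Finset.sum_comm]
    refine Finset.sum_eq_zero fun k _ => ?_
    calc ∑ a, g a * (L1 a i * L2 b j * L3 b k * T i j k)
        = (∑ a, g a * L1 a i) * (L2 b j * L3 b k * T i j k) := by
          rw [Finset.sum_mul]
          exact Finset.sum_congr rfl fun a _ => by ring
      _ = 0 := by rw [hz, zero_mul]
  simpa using hL.fintype_card_le_finrank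

/-- If `T` restricts to `⟨r⟩`, then `r ≤ Q(T)`. -/
theorem Restricts.le_subrank {ι1 ι2 ι3 : Type*} [Fintype ι1] [Fintype ι2] [Fintype ι3]
    {T : ι1 → ι2 → ι3 → F} {r : ℕ} (h : Restricts T (unitTensor F r)) : r ≤ subrank T :=
  le_csSup ⟨Fintype.card ι1, fun _ hs => Restricts.unitTensor_le_card hs⟩ h

/-- The min-rank is a lower bound on the rank of every nonzero element. -/
theorem minrank_le_rank {m n : Type*} [Fintype n] {𝒜 : Submodule F (Matrix m n F)}
    {A : Matrix m n F} (hA : A ∈ 𝒜) (h0 : A ≠ 0) : minrank 𝒜 ≤ A.rank :=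
  Nat.sInf_le ⟨A, hA, h0, rfl⟩

section Diagonal

variable {E G : Type*} [AddCommGroup E] [Module F E] [FiniteDimensional F E]
  [AddCommGroup G] [Module F G] [FiniteDimensional F G]

/-- If `B` maps a subspace `V` of codimension at most `d` into a subspace `P` of dimension at most
`d`, and `B` has rank at least `2 * d`, then `V` contains the preimage of `P`. -/
theorem comap_le_of_map_le_of_rank {B : E →ₗ[F] G} {V : Submodule F E} {P : Submodule F G} {d : ℕ}
    (hV : Module.finrank F E ≤ Module.finrank F V + d) (hP : Module.finrank F P ≤ d)
    (hB : 2 * d ≤ Module.finrank F (LinearMap.range B)) (h : V.map B ≤ P) :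
    P.comap B ≤ V := by
  have h1 := LinearMap.finrank_range_add_finrank_ker B
  have h2 := LinearMap.finrank_range_add_finrank_ker (B.domRestrict V)
  have h3 : LinearMap.range (B.domRestrict V) = V.map B := by
    rw [LinearMap.range_domRestrict]
  have h4 : (LinearMap.ker (B.domRestrict V)).map V.subtype = V ⊓ LinearMap.ker B := by
    ext v
    simp [and_comm]
  have h5 : Module.finrank F (LinearMap.ker (B.domRestrict V)) =
      Module.finrank F (V ⊓ LinearMap.ker B : Submodule F E) := by
    rw [← h4, Submodule.finrank_map_subtype_eq]
  rw [h3, h5] at h2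
  have h6 := Submodule.finrank_mono h
  have h7 := Submodule.finrank_mono (inf_le_right : V ⊓ LinearMap.ker B ≤ LinearMap.ker B)
  have hmap : V.map B = P := Submodule.eq_of_le_of_finrank_le h (by omega)
  have hker : V ⊓ LinearMap.ker B = LinearMap.ker B :=
    Submodule.eq_of_le_of_finrank_le inf_le_right (by omega)
  rw [← hmap, Submodule.comap_map_eq]
  exact sup_le le_rfl (inf_eq_right.mp hker)

/-- If every nontrivial combination of `A 0, …, A (c - 1)` is nonzero and has rank at least
`2c(c-1)`, then for `m ≤ c` there are `m` functionals and `m` vectors that diagonalize all the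
`A k` simultaneously, with linearly independent diagonals. -/
theorem exists_diagonalizing {c : ℕ} (A : Fin c → E →ₗ[F] G)
    (hne : ∀ w : Fin c → F, w ≠ 0 → ∑ k, w k • A k ≠ 0)
    (hrank : ∀ w : Fin c → F, w ≠ 0 →
      2 * c * (c - 1) ≤ Module.finrank F (LinearMap.range (∑ k, w k • A k)))
    (m : ℕ) (hm : m ≤ c) :
    ∃ (x : Fin m → Module.Dual F G) (y : Fin m → E),
      (∀ a b, a ≠ b → ∀ k, x a (A k (y b)) = 0) ∧
      LinearIndependent F (fun a k => x a (A k (y a)) : Fin m → Fin c → F) := by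
  induction m with
  | zero => exact ⟨Fin.elim0, Fin.elim0, fun a => a.elim0, linearIndependent_empty_type⟩
  | succ m ih =>
    obtain ⟨x, y, hxy, hli⟩ := ih (by omega)
    obtain ⟨w, hwker, hw⟩ := (Submodule.ne_bot_iff _).mp (LinearMap.ker_ne_bot_of_finrank_lt
      (f := Matrix.mulVecLin (Matrix.of fun (a : Fin m) (k : Fin c) => x a (A k (y a))))
      (by simpa using hm))
    have hw0 : ∀ a, ∑ k, x a (A k (y a)) * w k = 0 := fun a => by
      simpa [Matrix.mulVec, dotProduct] using congrFun (LinearMap.mem_ker.mp hwker) a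
    set B : E →ₗ[F] G := ∑ k, w k • A k with hBdef
    have hBapp : ∀ v, B v = ∑ k, w k • A k v := fun v => by simp [hBdef]
    let Φ : E →ₗ[F] (Fin c × Fin m → F) := LinearMap.pi fun p => x p.2 ∘ₗ A p.1
    let P : Submodule F G := Submodule.span F (Set.range fun p : Fin c × Fin m => A p.1 (y p.2))
    have hcm : c * m ≤ c * (c - 1) := Nat.mul_le_mul_left c (by omega)
    have hmem : ∀ v, v ∈ LinearMap.ker Φ ↔ ∀ k b, x b (A k v) = 0 := fun v => by
      simp [Φ, funext_iff]
    have hV : Module.finrank F E ≤ Module.finrank F (LinearMap.ker Φ) + c * (c - 1) := by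
      have h1 := LinearMap.finrank_range_add_finrank_ker Φ
      have h2 := Submodule.finrank_le (LinearMap.range Φ)
      simp at h2
      omega
    have hP : Module.finrank F P ≤ c * (c - 1) := by
      have h1 := finrank_range_le_card (R := F) (fun p : Fin c × Fin m => A p.1 (y p.2))
      simp only [Fintype.card_prod, Fintype.card_fin] at h1
      exact h1.trans hcm
    have hBy : ∀ b, B (y b) ∈ P := fun b => by
      rw [hBapp]
      exact Submodule.sum_mem _ fun k _ =>
        Submodule.smul_mem _ _ (Submodule.subset_span ⟨(k, b), rfl⟩)
    have hnot : ¬ (LinearMap.ker Φ).map B ≤ P := by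
      intro hle
      have hcomap := comap_le_of_map_le_of_rank hV hP
        (by simpa [mul_assoc] using hrank w hw) hle
      rcases Nat.eq_zero_or_pos m with rfl | hpos
      · refine hne w hw (LinearMap.ext fun v => ?_)
        have hv : B v ∈ P := hle ⟨v, (hmem v).mpr fun _ b => b.elim0, rfl⟩
        have hbot : P = ⊥ := by
          simp only [P, Set.range_eq_empty, Submodule.span_empty]
        rw [hbot] at hv
        exact hv
      · refine hli.ne_zero ⟨0, hpos⟩ (funext fun k => ?_)
        exact (hmem _).mp (hcomap (hBy ⟨0, hpos⟩)) k ⟨0, hpos⟩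
    obtain ⟨_, ⟨y', hy', rfl⟩, hyP⟩ := SetLike.not_le_iff_exists.mp hnot
    obtain ⟨x', hx', hxP⟩ := Submodule.exists_le_ker_of_notMem hyP
    have hx0 : ∀ k b, x' (A k (y b)) = 0 := fun k b =>
      hxP (Submodule.subset_span ⟨(k, b), rfl⟩)
    have hy0 := (hmem y').mp hy'
    refine ⟨Fin.cons x' x, Fin.cons y' y, ?_, ?_⟩
    · intro a b hab k
      cases a using Fin.cases with
      | zero =>
        cases b using Fin.cases with
        | zero => exact absurd rfl hab
        | succ b => simpa using hx0 k b
      | succ a =>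
        cases b using Fin.cases with
        | zero => simpa using hy0 k a
        | succ b => simpa using hxy a b (fun h => hab (congrArg Fin.succ h)) k
    · have hcons : (fun a k => (Fin.cons x' x : Fin (m + 1) → Module.Dual F G) a
            (A k ((Fin.cons y' y : Fin (m + 1) → E) a)) : Fin (m + 1) → Fin c → F) =
          Fin.cons (fun k => x' (A k y')) (fun a k => x a (A k (y a))) := by
        funext a
        cases a using Fin.cases <;> simp
      rw [hcons, linearIndependent_finCons]
      refine ⟨hli, fun hspan => hx' ?_⟩
      have hle : Submodule.span F (Set.range fun a k => x a (A k (y a))) ≤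
          LinearMap.ker (dotProductBilin F F w) := by
        rw [Submodule.span_le]
        rintro _ ⟨a, rfl⟩
        simpa [dotProduct, mul_comm] using hw0 a
      simpa [dotProduct, hBapp] using hle hspan

end Diagonal

/-- If `c` of the 3-slices of a tensor `T` are linearly independent
and the min-rank of their span is at least `2c(c−1)`, then `Q(T) ≥ c`. -/
theorem subrank_ge_of_minrank_slices (F : Type*) [Field F] (n1 n2 n3 c : ℕ)
    (T : Fin n1 → Fin n2 → Fin n3 → F) (κ : Fin c → Fin n3)
    (hli : LinearIndependent F
      (fun t : Fin c => (Matrix.of fun i j => T i j (κ t) : Matrix (Fin n1) (Fin n2) F)))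
    (hmin : 2 * c * (c - 1) ≤ minrank (Submodule.span F
      (Set.range fun t : Fin c =>
        (Matrix.of fun i j => T i j (κ t) : Matrix (Fin n1) (Fin n2) F)))) :
    c ≤ subrank T := by
  set A : Fin c → Matrix (Fin n1) (Fin n2) F := fun t => Matrix.of fun i j => T i j (κ t) with hA
  have hsum : ∀ w : Fin c → F,
      ∑ k, w k • (A k).mulVecLin = (∑ k, w k • A k).mulVecLin := fun w => by
    simp only [← Matrix.toLin'_apply', map_sum, map_smul]
  have hne : ∀ w : Fin c → F, w ≠ 0 → ∑ k, w k • A k ≠ 0 := fun w hw h0 =>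
    hw (funext (Fintype.linearIndependent_iff.mp hli w h0))
  obtain ⟨x, y, hxy, hM⟩ := exists_diagonalizing (fun k => (A k).mulVecLin)
    (fun w hw h0 => hne w hw (by
      rw [hsum, ← Matrix.toLin'_apply'] at h0
      exact Matrix.toLin'.map_eq_zero_iff.mp h0))
    (fun w hw => by
      rw [hsum]
      exact hmin.trans (minrank_le_rank (Submodule.sum_mem _ fun k _ =>
        Submodule.smul_mem _ _ (Submodule.subset_span ⟨k, rfl⟩)) (hne w hw)))
    c le_rfl
  set M : Matrix (Fin c) (Fin c) F := Matrix.of fun a k => x a ((A k).mulVec (y a)) with hMdef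
  have hunit : IsUnit M := Matrix.linearIndependent_rows_iff_isUnit.mp hM
  obtain ⟨N, hN⟩ := hunit.exists_right_inv
  have hform : ∀ a b k, x a ((A k).mulVec (y b)) =
      ∑ i, ∑ j, x a (Pi.single i 1) * y b j * T i j (κ k) := by
    intro a b k
    rw [LinearMap.pi_apply_eq_sum_univ (x a)]
    refine Finset.sum_congr rfl fun i _ => ?_
    have hs : (fun j => if i = j then (1 : F) else 0) = Pi.single i 1 := by
      funext j
      simp [Pi.single_apply, eq_comm]
    simp only [hs, Matrix.mulVec, dotProduct, hA, Matrix.of_apply, smul_eq_mul, Finset.sum_mul]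
    exact Finset.sum_congr rfl fun j _ => by ring
  apply Restricts.le_subrank
  refine ⟨fun a i => x a (Pi.single i 1), y, fun t l => ∑ k, if κ k = l then N k t else 0, ?_⟩
  intro a b t
  have hslice : ∀ i j, ∑ l, x a (Pi.single i 1) * y b j *
      (∑ k, if κ k = l then N k t else 0) * T i j l =
      ∑ k, N k t * (x a (Pi.single i 1) * y b j * T i j (κ k)) := by
    intro i j
    simp_rw [Finset.mul_sum, Finset.sum_mul]
    rw [Finset.sum_comm]
    refine Finset.sum_congr rfl fun k _ => ?_
    simp
    ring
  have hcontract : ∑ i, ∑ j, ∑ l, x a (Pi.single i 1) * y b j *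
      (∑ k, if κ k = l then N k t else 0) * T i j l = ∑ k, N k t * x a ((A k).mulVec (y b)) := by
    simp_rw [hslice, hform, Finset.mul_sum]
    rw [Finset.sum_comm_cycle]
  rw [hcontract]
  by_cases hab : a = b
  · subst hab
    have h := congrFun (congrFun hN a) t
    rw [Matrix.mul_apply, Matrix.one_apply] at h
    simpa [unitTensor, hMdef, mul_comm] using h.symm
  · have h0 : ∀ k, x a ((A k).mulVec (y b)) = 0 := hxy a b hab
    simp [unitTensor, hab, h0]

end Paper
end

section
/- Let F be a field and let 𝒜 ⊆ F^{a×b} and ℬ ⊆ F^{c×d} be nonzero matrix subspaces such that every matrix in 𝒜 is diagonal. Then minrank(𝒜 ⊗ ℬ) ≥ minrank(𝒜) · minrank(ℬ). -/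
open scoped BigOperators

namespace Paper

variable {F : Type*} [Field F]

/-- A matrix whose nonzero rows all lie in `S` has rank at most `#S`. -/
theorem rank_le_card_of_row_eq_zero {m n : Type*} [DecidableEq m] [Fintype n]
    (A : Matrix m n F) (S : Finset m) (h : ∀ i ∉ S, ∀ j, A i j = 0) : A.rank ≤ S.card := by
  have hA : A = (Matrix.of fun (i : m) (s : S) => if i = s then (1 : F) else 0) *
      A.submatrix (Subtype.val : S → m) id := by
    ext i j
    rw [Matrix.mul_apply]
    by_cases hi : i ∈ S
    · rw [Finset.sum_eq_single (⟨i, hi⟩ : S)]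
      · simp
      · intro s _ hs
        have : i ≠ s := fun e => hs (Subtype.ext e.symm)
        simp [this]
      · simp
    · rw [h i hi j, Finset.sum_eq_zero]
      intro s _
      have : i ≠ s := fun e => hi (e ▸ s.2)
      simp [this]
  rw [hA]
  refine (Matrix.rank_mul_le_right _ _).trans ((Matrix.rank_le_card_height _).trans ?_)
  simp

/-- The rank of a block diagonal matrix is at least the sum of the ranks of its blocks. -/
theorem sum_rank_le_rank_blockDiagonal {o m n : Type*} [Fintype o] [DecidableEq o] [Fintype m]
    [Fintype n] (M : o → Matrix m n F) :
    ∑ k, (M k).rank ≤ (Matrix.blockDiagonal M).rank := by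
  let φ : (∀ k, LinearMap.range (M k).mulVecLin) →ₗ[F] (m × o → F) :=
    { toFun := fun v p => (v p.2 : m → F) p.1
      map_add' := fun _ _ => rfl
      map_smul' := fun _ _ => rfl }
  have hφ : ∀ v, φ v ∈ LinearMap.range (Matrix.blockDiagonal M).mulVecLin := by
    intro v
    choose w hw using fun k => (v k).2
    refine ⟨fun p => w p.2 p.1, ?_⟩
    ext ⟨i, k⟩
    change _ = (v k : m → F) i
    rw [← hw k]
    simp [Matrix.mulVec, dotProduct, Fintype.sum_prod_type, Matrix.blockDiagonal_apply]
  have hinj : Function.Injective (φ.codRestrict _ hφ) := by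
    intro v w h
    ext k i
    exact congrFun (congrArg Subtype.val h) (i, k)
  have := LinearMap.finrank_le_finrank_of_injective hinj
  rwa [Module.finrank_pi_fintype] at this

theorem exists_rank_eq_minrank {m n : Type*} [Fintype n] {𝒜 : Submodule F (Matrix m n F)}
    (h : 𝒜 ≠ ⊥) : ∃ A ∈ 𝒜, A ≠ 0 ∧ A.rank = minrank 𝒜 := by
  obtain ⟨A, hA, h0⟩ := 𝒜.ne_bot_iff.mp h
  exact Nat.sInf_mem (s := {r : ℕ | ∃ A ∈ 𝒜, A ≠ 0 ∧ A.rank = r}) ⟨A.rank, A, hA, h0, rfl⟩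

section KroneckerSpan

variable {m n p q : Type*} {𝒜 : Submodule F (Matrix m n F)} {ℬ : Submodule F (Matrix p q F)}
  {C : Matrix (m × p) (n × q) F}

theorem block_mem_of_mem_span_kronecker
    (hC : C ∈ Submodule.span F {C : Matrix (m × p) (n × q) F |
      ∃ A ∈ 𝒜, ∃ B ∈ ℬ, C = Matrix.kroneckerMap (· * ·) A B}) (i : m) (j : n) :
    (Matrix.of fun k l => C (i, k) (j, l)) ∈ ℬ := by
  induction hC using Submodule.span_induction with
  | mem C h =>
    obtain ⟨A, -, B, hB, rfl⟩ := h
    exact ℬ.smul_mem (A i j) hB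
  | zero => exact ℬ.zero_mem
  | add C D _ _ hC hD => exact ℬ.add_mem hC hD
  | smul t C _ hC => exact ℬ.smul_mem t hC

theorem slice_mem_of_mem_span_kronecker
    (hC : C ∈ Submodule.span F {C : Matrix (m × p) (n × q) F |
      ∃ A ∈ 𝒜, ∃ B ∈ ℬ, C = Matrix.kroneckerMap (· * ·) A B}) (k : p) (l : q) :
    (Matrix.of fun i j => C (i, k) (j, l)) ∈ 𝒜 := by
  induction hC using Submodule.span_induction with
  | mem C h =>
    obtain ⟨A, hA, B, -, rfl⟩ := h
    convert 𝒜.smul_mem (B k l) hA using 1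
    ext i j
    simp [mul_comm]
  | zero => exact 𝒜.zero_mem
  | add C D _ _ hC hD => exact 𝒜.add_mem hC hD
  | smul t C _ hC => exact 𝒜.smul_mem t hC

theorem span_kronecker_ne_bot (h𝒜 : 𝒜 ≠ ⊥) (hℬ : ℬ ≠ ⊥) :
    Submodule.span F {C : Matrix (m × p) (n × q) F |
      ∃ A ∈ 𝒜, ∃ B ∈ ℬ, C = Matrix.kroneckerMap (· * ·) A B} ≠ ⊥ := by
  obtain ⟨A, hA, hA0⟩ := 𝒜.ne_bot_iff.mp h𝒜
  obtain ⟨B, hB, hB0⟩ := ℬ.ne_bot_iff.mp hℬ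
  refine (Submodule.ne_bot_iff _).mpr ⟨_, Submodule.subset_span ⟨A, hA, B, hB, rfl⟩, fun h => ?_⟩
  obtain ⟨i, j, hij⟩ : ∃ i j, A i j ≠ 0 := by
    by_contra! h'
    exact hA0 (Matrix.ext h')
  obtain ⟨k, l, hkl⟩ : ∃ k l, B k l ≠ 0 := by
    by_contra! h'
    exact hB0 (Matrix.ext h')
  exact mul_ne_zero hij hkl (congrFun (congrFun h (i, k)) (j, l))

end KroneckerSpan

/-- Min-rank is supermultiplicative under the Kronecker/tensor
product of matrix subspaces, provided all matrices in the first subspace are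
diagonal. -/
theorem minrank_kronecker_supermul (F : Type*) [Field F] (a b c d : ℕ)
    (𝒜 : Submodule F (Matrix (Fin a) (Fin b) F))
    (ℬ : Submodule F (Matrix (Fin c) (Fin d) F))
    (h𝒜 : 𝒜 ≠ ⊥) (hℬ : ℬ ≠ ⊥)
    (hdiag : ∀ A ∈ 𝒜, ∀ (i : Fin a) (j : Fin b), (i : ℕ) ≠ (j : ℕ) → A i j = 0) :
    minrank 𝒜 * minrank ℬ ≤
      minrank (Submodule.span F
        {C : Matrix (Fin a × Fin c) (Fin b × Fin d) F |
          ∃ A ∈ 𝒜, ∃ B ∈ ℬ, C = Matrix.kroneckerMap (· * ·) A B}) := by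
  classical
  obtain ⟨C, hC, hC0, hrank⟩ := exists_rank_eq_minrank (span_kronecker_ne_bot h𝒜 hℬ)
  rw [← hrank]
  have hslice := slice_mem_of_mem_span_kronecker hC
  have hblock := block_mem_of_mem_span_kronecker hC
  have hoff : ∀ (i : Fin a) (j : Fin b), (i : ℕ) ≠ j → ∀ k l, C (i, k) (j, l) = 0 :=
    fun i j hij k l => hdiag _ (hslice k l) i j hij
  let S : Finset (Fin a) := Finset.univ.filter fun i =>
    ∃ j : Fin b, (i : ℕ) = j ∧ (Matrix.of fun k l => C (i, k) (j, l)) ≠ 0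
  have h𝒜S : minrank 𝒜 ≤ S.card := by
    obtain ⟨⟨i, k⟩, ⟨j, l⟩, hne⟩ : ∃ x y, C x y ≠ 0 := by
      by_contra! h
      exact hC0 (Matrix.ext h)
    refine (minrank_le_rank (hslice k l) fun h => hne (congrFun (congrFun h i) j)).trans
      (rank_le_card_of_row_eq_zero _ _ fun i' hi' j' => ?_)
    by_contra h
    refine hi' (Finset.mem_filter.mpr ⟨Finset.mem_univ _, j', ?_, fun h' => ?_⟩)
    · by_contra hij
      exact h (hoff i' j' hij k l)
    · exact h (congrFun (congrFun h' k) l)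
  choose σ hσ hσ0 using fun i : S => (Finset.mem_filter.mp i.2).2
  let M : S → Matrix (Fin c) (Fin d) F := fun i => Matrix.of fun k l => C (i, k) (σ i, l)
  have hsub : C.submatrix (fun x : Fin c × S => ((x.2 : Fin a), x.1))
      (fun x : Fin d × S => (σ x.2, x.1)) = Matrix.blockDiagonal M := by
    ext ⟨k, i⟩ ⟨l, i'⟩
    rw [Matrix.blockDiagonal_apply]
    split_ifs with h
    · obtain rfl : i = i' := h
      rfl
    · refine hoff _ _ (fun hi => h (Subtype.ext (Fin.ext ?_))) k l
      exact hi.trans (hσ i').symm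
  calc minrank 𝒜 * minrank ℬ ≤ S.card * minrank ℬ := Nat.mul_le_mul_right _ h𝒜S
    _ = ∑ _i : S, minrank ℬ := by simp
    _ ≤ ∑ i : S, (M i).rank :=
      Finset.sum_le_sum fun i _ => minrank_le_rank (hblock i (σ i)) (hσ0 i)
    _ ≤ (Matrix.blockDiagonal M).rank := sum_rank_le_rank_blockDiagonal M
    _ ≤ C.rank := hsub ▸ Matrix.rank_submatrix_le C _ _

end Paper
end

section
/- Let T ∈ F^{n1} ⊗ F^{n2} ⊗ F^{n3} be a concise tensor over a field F. Then for every choice of distinct i, j, k ∈ {1,2,3} it holds that ρ_{i,j}(T) · max{Q_i(T), Q_j(T)} ≥ n_k. -/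
open scoped BigOperators

namespace Paper

variable {F : Type*} [Field F]

/-- A subspace of row vectors containing, for each position of `s`, a vector whose first nonzero
entry is at that position has dimension at least `s.card`. -/
lemma card_le_finrank_of_leading {n : ℕ} (W : Submodule F (Fin n → F)) (s : Finset (Fin n))
    (h : ∀ a ∈ s, ∃ v ∈ W, v a ≠ 0 ∧ ∀ a' < a, v a' = 0) :
    s.card ≤ Module.finrank F W := by
  choose! v hvW hv hv0 using h
  let M : Matrix s s F := Matrix.of fun a a' => v a a'
  have hM : M.det ≠ 0 := by
    have hup : M.IsUpperTriangular := by
      intro a a' hlt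
      exact hv0 a a.2 a' hlt
    rw [Matrix.det_of_isUpperTriangular hup]
    exact Finset.prod_ne_zero_iff.2 fun a _ => hv a a.2
  let res : W →ₗ[F] (s → F) := (LinearMap.funLeft F F (Subtype.val : s → Fin n)) ∘ₗ W.subtype
  have hli : LinearIndependent F (fun a : s => (⟨v a, hvW a a.2⟩ : W)) :=
    LinearIndependent.of_comp res (Matrix.linearIndependent_rows_of_det_ne_zero hM)
  simpa using hli.fintype_card_le_finrank

lemma exists_isPivot {n1 n2 : ℕ} {A : Matrix (Fin n1) (Fin n2) F} (hA : A ≠ 0) :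
    ∃ p, IsPivot A p := by
  classical
  let N : Finset (Fin n1 ×ₗ Fin n2) :=
    Finset.univ.filter fun q => A (ofLex q).1 (ofLex q).2 ≠ 0
  have hN : N.Nonempty := by
    by_contra hemp
    refine hA (Matrix.ext fun i j => ?_)
    by_contra hij
    exact hemp ⟨toLex (i, j), by simpa [N] using hij⟩
  refine ⟨ofLex (N.min' hN), (Finset.mem_filter.1 (N.min'_mem hN)).2, fun q hq => ?_⟩
  have hle := N.min'_le (toLex q) (by simpa [N] using hq)
  exact Prod.Lex.le_iff.1 hle

/-- A matrix subspace has at least as many pivots as its dimension. -/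
lemma finrank_le_card_of_pivotSet_subset {n1 n2 : ℕ}
    (𝒜 : Submodule F (Matrix (Fin n1) (Fin n2) F)) (P : Finset (Fin n1 × Fin n2))
    (hP : ∀ p ∈ pivotSet 𝒜, p ∈ P) : Module.finrank F 𝒜 ≤ P.card := by
  let ev : 𝒜 →ₗ[F] (P → F) :=
    { toFun := fun A p => A.1 p.1.1 p.1.2
      map_add' := fun _ _ => rfl
      map_smul' := fun _ _ => rfl }
  have hinj : Function.Injective ev := by
    refine (injective_iff_map_eq_zero ev).2 fun A hA => ?_
    by_contra hne
    obtain ⟨p, hp⟩ := exists_isPivot (A := A.1) fun h0 => hne (Subtype.ext h0)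
    exact hp.1 (congrFun hA ⟨p, hP p ⟨A.1, A.2, hp⟩⟩)
  simpa using LinearMap.finrank_le_finrank_of_injective hinj

lemma map_mem_span_range {κ V W : Type*} [AddCommGroup V] [Module F V] [AddCommGroup W]
    [Module F W] (L : V →ₗ[F] W) (S : κ → V) {x : V} (hx : x ∈ Submodule.span F (Set.range S)) :
    L x ∈ Submodule.span F (Set.range fun k => L (S k)) := by
  have h := Submodule.mem_map_of_mem (f := L) hx
  rwa [Submodule.map_span, ← Set.range_comp] at h

lemma exists_cover_card_eq_rho {n1 n2 : ℕ} (𝒜 : Submodule F (Matrix (Fin n1) (Fin n2) F)) :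
    ∃ (S1 : Finset (Fin n1)) (S2 : Finset (Fin n2)), S1.card + S2.card = rho 𝒜 ∧
      ∀ p ∈ pivotSet 𝒜, p.1 ∈ S1 ∨ p.2 ∈ S2 :=
  Nat.sInf_mem (s := {r : ℕ | ∃ (S1 : Finset (Fin n1)) (S2 : Finset (Fin n2)),
    S1.card + S2.card = r ∧ ∀ p ∈ pivotSet 𝒜, p.1 ∈ S1 ∨ p.2 ∈ S2})
    ⟨_, Finset.univ, Finset.univ, rfl, fun _ _ => Or.inl (Finset.mem_univ _)⟩

lemma card_le_rank_of_row_pivots {n n1 n2 : ℕ} (S : Fin n → Matrix (Fin n1) (Fin n2) F)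
    (a : Fin n1) (s : Finset (Fin n2))
    (hs : ∀ b ∈ s, (a, b) ∈ pivotSet (Submodule.span F (Set.range S))) :
    s.card ≤ (Matrix.of fun k j => S k a j).rank := by
  rw [Matrix.rank_eq_finrank_span_row]
  refine card_le_finrank_of_leading _ _ fun b hb => ?_
  obtain ⟨A, hA, hp, hmin⟩ := hs b hb
  let row : Matrix (Fin n1) (Fin n2) F →ₗ[F] (Fin n2 → F) :=
    { toFun := fun B => B a
      map_add' := fun _ _ => rfl
      map_smul' := fun _ _ => rfl }
  refine ⟨row A, map_mem_span_range row S hA, hp, fun b' hb' => ?_⟩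
  by_contra hne
  rcases hmin (a, b') hne with h | h
  · exact lt_irrefl _ h
  · exact absurd hb' (not_lt.2 h.2)

lemma card_le_rank_of_col_pivots {n n1 n2 : ℕ} (S : Fin n → Matrix (Fin n1) (Fin n2) F)
    (b : Fin n2) (s : Finset (Fin n1))
    (hs : ∀ a ∈ s, (a, b) ∈ pivotSet (Submodule.span F (Set.range S))) :
    s.card ≤ (Matrix.of fun k i => S k i b).rank := by
  rw [Matrix.rank_eq_finrank_span_row]
  refine card_le_finrank_of_leading _ _ fun a ha => ?_
  obtain ⟨A, hA, hp, hmin⟩ := hs a ha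
  let col : Matrix (Fin n1) (Fin n2) F →ₗ[F] (Fin n1 → F) :=
    { toFun := fun B i => B i b
      map_add' := fun _ _ => rfl
      map_smul' := fun _ _ => rfl }
  refine ⟨col A, map_mem_span_range col S hA, hp, fun a' ha' => ?_⟩
  by_contra hne
  rcases hmin (a', b) hne with h | h
  · exact lt_asymm ha' h
  · exact absurd ha' (not_lt.2 h.1.le)

/-- If all slices, along either matrix direction, of a linearly independent family of matrices have
rank at most `r`, then the family has at most `rho * r` members. -/
lemma card_le_rho_mul {n n1 n2 r : ℕ} (S : Fin n → Matrix (Fin n1) (Fin n2) F)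
    (hS : LinearIndependent F S)
    (hrow : ∀ a, (Matrix.of fun k j => S k a j).rank ≤ r)
    (hcol : ∀ b, (Matrix.of fun k i => S k i b).rank ≤ r) :
    n ≤ rho (Submodule.span F (Set.range S)) * r := by
  classical
  set 𝒜 := Submodule.span F (Set.range S)
  obtain ⟨S1, S2, hcard, hcov⟩ := exists_cover_card_eq_rho 𝒜
  let R : Fin n1 → Finset (Fin n2) := fun a => Finset.univ.filter fun b => (a, b) ∈ pivotSet 𝒜
  let C : Fin n2 → Finset (Fin n1) := fun b => Finset.univ.filter fun a => (a, b) ∈ pivotSet 𝒜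
  have hR : ∀ a, (R a).card ≤ r := fun a =>
    (card_le_rank_of_row_pivots S a (R a) fun b hb => (Finset.mem_filter.1 hb).2).trans (hrow a)
  have hC : ∀ b, (C b).card ≤ r := fun b =>
    (card_le_rank_of_col_pivots S b (C b) fun a ha => (Finset.mem_filter.1 ha).2).trans (hcol b)
  let P : Finset (Fin n1 × Fin n2) :=
    (S1.biUnion fun a => (R a).image fun b => (a, b)) ∪
      (S2.biUnion fun b => (C b).image fun a => (a, b))
  have hP : ∀ p ∈ pivotSet 𝒜, p ∈ P := by
    rintro ⟨a, b⟩ hp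
    rcases hcov _ hp with h | h
    · exact Finset.mem_union_left _ (Finset.mem_biUnion.2
        ⟨a, h, Finset.mem_image.2 ⟨b, by simpa [R] using hp, rfl⟩⟩)
    · exact Finset.mem_union_right _ (Finset.mem_biUnion.2
        ⟨b, h, Finset.mem_image.2 ⟨a, by simpa [C] using hp, rfl⟩⟩)
  calc n = Module.finrank F 𝒜 := by simpa using (finrank_span_eq_card hS).symm
    _ ≤ P.card := finrank_le_card_of_pivotSet_subset 𝒜 P hP
    _ ≤ S1.card * r + S2.card * r := (Finset.card_union_le _ _).trans (add_le_add
        (Finset.card_biUnion_le_card_mul _ _ _ fun a _ => Finset.card_image_le.trans (hR a))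
        (Finset.card_biUnion_le_card_mul _ _ _ fun b _ => Finset.card_image_le.trans (hC b)))
    _ = rho 𝒜 * r := by rw [← add_mul, hcard]

lemma linearIndependent_row_of_rank_eq {ι κ : Type*} [Fintype ι] [Fintype κ] (M : Matrix ι κ F)
    (h : M.rank = Fintype.card ι) : LinearIndependent F M.row := by
  rw [linearIndependent_iff_card_eq_finrank_span, ← h, Matrix.rank_eq_finrank_span_row]
  rfl

/-- The linear map listing the entries of a matrix. -/
def entriesMap (F : Type*) [Field F] (m n : Type*) : Matrix m n F →ₗ[F] (m × n → F) where
  toFun A p := A p.1 p.2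
  map_add' _ _ := rfl
  map_smul' _ _ := rfl

lemma linearIndependent_of_rank_entries_eq {ι m n : Type*} [Fintype ι] [Fintype m] [Fintype n]
    (S : ι → Matrix m n F)
    (h : (Matrix.of fun k (p : m × n) => S k p.1 p.2).rank = Fintype.card ι) :
    LinearIndependent F S ∧ LinearIndependent F fun k => (S k).transpose := by
  have hS : LinearIndependent F S :=
    LinearIndependent.of_comp (entriesMap F m n) (linearIndependent_row_of_rank_eq _ h)
  exact ⟨hS, hS.map' (Matrix.transposeLinearEquiv m n F F).toLinearMap
    (LinearEquiv.ker _)⟩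

lemma rank_le_maxrank {m n : Type*} [Fintype n] {𝒜 : Submodule F (Matrix m n F)}
    {A : Matrix m n F} (hA : A ∈ 𝒜) : A.rank ≤ maxrank 𝒜 := by
  refine le_csSup ⟨Fintype.card n, ?_⟩ ⟨A, hA, rfl⟩
  rintro _ ⟨B, -, rfl⟩
  exact B.rank_le_card_width

section SliceRank

variable {n1 n2 n3 : ℕ} (T : Fin n1 → Fin n2 → Fin n3 → F)

lemma rank_slice_le_Q1 (i : Fin n1) :
    (Matrix.of fun j k => T i j k).rank ≤ Q1 T ∧ (Matrix.of fun k j => T i j k).rank ≤ Q1 T := by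
  have h : (Matrix.of fun j k => T i j k).rank ≤ Q1 T :=
    rank_le_maxrank (Submodule.subset_span ⟨i, rfl⟩)
  exact ⟨h, by rw [← Matrix.rank_transpose]; exact h⟩

lemma rank_slice_le_Q2 (j : Fin n2) :
    (Matrix.of fun i k => T i j k).rank ≤ Q2 T ∧ (Matrix.of fun k i => T i j k).rank ≤ Q2 T := by
  have h : (Matrix.of fun i k => T i j k).rank ≤ Q2 T :=
    rank_le_maxrank (Submodule.subset_span ⟨j, rfl⟩)
  exact ⟨h, by rw [← Matrix.rank_transpose]; exact h⟩

lemma rank_slice_le_Q3 (k : Fin n3) :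
    (Matrix.of fun i j => T i j k).rank ≤ Q3 T ∧ (Matrix.of fun j i => T i j k).rank ≤ Q3 T := by
  have h : (Matrix.of fun i j => T i j k).rank ≤ Q3 T :=
    rank_le_maxrank (Submodule.subset_span ⟨k, rfl⟩)
  exact ⟨h, by rw [← Matrix.rank_transpose]; exact h⟩

end SliceRank

/-- For a concise tensor `T` of format `(n1, n2, n3)` and any
distinct `i, j, k ∈ {1,2,3}`: `ρ_{i,j}(T) · max{Q_i(T), Q_j(T)} ≥ n_k`.
Here `ρ_{i,j}` is `ρ` of the span of the `k`-slices with rows indexed by direction `i`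
and columns by direction `j`. -/
theorem rho_mul_maxrank_ge (F : Type*) [Field F] (n1 n2 n3 : ℕ)
    (T : Fin n1 → Fin n2 → Fin n3 → F) (hT : Concise T)
    (i j k : Fin 3) (hij : i ≠ j) (hik : i ≠ k) (hjk : j ≠ k) :
    ![n1, n2, n3] k ≤
      ![![0, rho (span12 T), rho (span13 T)],
        ![rho (span21 T), 0, rho (span23 T)],
        ![rho (span31 T), rho (span32 T), 0]] i j *
      max (![Q1 T, Q2 T, Q3 T] i) (![Q1 T, Q2 T, Q3 T] j) := by
  obtain ⟨h1, h2, h3⟩ := hT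
  obtain ⟨h23, h32⟩ := linearIndependent_of_rank_entries_eq
    (fun i => Matrix.of fun j k => T i j k) h1
  obtain ⟨h13, h31⟩ := linearIndependent_of_rank_entries_eq
    (fun j => Matrix.of fun i k => T i j k) h2
  obtain ⟨h12, h21⟩ := linearIndependent_of_rank_entries_eq
    (fun k => Matrix.of fun i j => T i j k) h3
  have q1 := rank_slice_le_Q1 T
  have q2 := rank_slice_le_Q2 T
  have q3 := rank_slice_le_Q3 T
  have c12 : n3 ≤ rho (span12 T) * max (Q1 T) (Q2 T) := card_le_rho_mul _ h12
    (fun a => (q1 a).2.trans (le_max_left _ _)) (fun b => (q2 b).2.trans (le_max_right _ _))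
  have c21 : n3 ≤ rho (span21 T) * max (Q2 T) (Q1 T) := card_le_rho_mul _ h21
    (fun a => (q2 a).2.trans (le_max_left _ _)) (fun b => (q1 b).2.trans (le_max_right _ _))
  have c13 : n2 ≤ rho (span13 T) * max (Q1 T) (Q3 T) := card_le_rho_mul _ h13
    (fun a => (q1 a).1.trans (le_max_left _ _)) (fun b => (q3 b).2.trans (le_max_right _ _))
  have c31 : n2 ≤ rho (span31 T) * max (Q3 T) (Q1 T) := card_le_rho_mul _ h31
    (fun a => (q3 a).2.trans (le_max_left _ _)) (fun b => (q1 b).1.trans (le_max_right _ _))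
  have c23 : n1 ≤ rho (span23 T) * max (Q2 T) (Q3 T) := card_le_rho_mul _ h23
    (fun a => (q2 a).1.trans (le_max_left _ _)) (fun b => (q3 b).1.trans (le_max_right _ _))
  have c32 : n1 ≤ rho (span32 T) * max (Q3 T) (Q2 T) := card_le_rho_mul _ h32
    (fun a => (q3 a).1.trans (le_max_left _ _)) (fun b => (q2 b).1.trans (le_max_right _ _))
  fin_cases i <;> fin_cases j <;> fin_cases k <;>
    first
    | exact absurd rfl hij
    | exact absurd rfl hik
    | exact absurd rfl hjk
    | assumption

end Paper
end
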